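/- arXiv:2204.13665 — 9 statements merged into one kernel-verified Lean document; each statement's English description precedes it below -/
import Mathlib

section
/- Let C > 0 and let a, b : [0,∞) → ℝ be differentiable functions with nonnegative values satisfying a'(t) = b(t) and b'(t) ≤ C·a(t) for all t ≥ 0. Then for all t ≥ 0: a(t) ≤ a(0)·cosh(√C·t) + (b(0)/√C)·sinh(√C·t), and b(t) ≤ √C·( a(0)·sinh(√C·t) + (b(0)/√C)·cosh(√C·t) ). -/
open Set in
/-- A function on `[0, ∞)` with nonpositive derivative is bounded above by its initial value. -/
theorem le_initial_of_hasDerivWithinAt_nonpos {f f' : ℝ → ℝ}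
    (hf : ∀ t, 0 ≤ t → HasDerivWithinAt f (f' t) (Ici 0) t)
    (hf' : ∀ t, 0 ≤ t → f' t ≤ 0) {t : ℝ} (ht : 0 ≤ t) : f t ≤ f 0 := by
  have hanti : AntitoneOn f (Ici 0) := by
    refine antitoneOn_of_hasDerivWithinAt_nonpos (f' := f') (convex_Ici 0)
      (fun x hx => (hf x hx).continuousWithinAt) (fun x hx => ?_) (fun x hx => ?_)
    · exact (hf x (interior_subset hx)).mono interior_subset
    · exact hf' x (interior_subset hx)
  exact hanti self_mem_Ici ht ht

open Set in
/-- Integrating factor: if `f' ≤ k f` on `[0, ∞)` and `f 0 = 0`, then `f ≤ 0` on `[0, ∞)`. -/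
theorem nonpos_of_hasDerivWithinAt_le_mul {f f' : ℝ → ℝ} (k : ℝ)
    (hf : ∀ t, 0 ≤ t → HasDerivWithinAt f (f' t) (Ici 0) t)
    (hf' : ∀ t, 0 ≤ t → f' t ≤ k * f t) (h0 : f 0 = 0) {t : ℝ} (ht : 0 ≤ t) : f t ≤ 0 := by
  have hexp (x : ℝ) : HasDerivAt (fun x => Real.exp (-k * x)) (Real.exp (-k * x) * -k) x := by
    simpa using ((hasDerivAt_id x).const_mul (-k)).exp
  have h := le_initial_of_hasDerivWithinAt_nonpos
    (f := fun x => f x * Real.exp (-k * x))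
    (fun x hx => (hf x hx).mul (hexp x).hasDerivWithinAt)
    (fun x hx => by nlinarith [hf' x hx, Real.exp_pos (-k * x)]) ht
  simp only [h0, zero_mul] at h
  exact nonpos_of_mul_nonpos_left h (Real.exp_pos _)

open Set in
/-- If `w' = z`, `z' ≤ s² w` on `[0, ∞)` and `w 0 = z 0 = 0`, then `w ≤ 0` and `z ≤ 0`. -/
theorem nonpos_of_second_order_le (s : ℝ) {w z z' : ℝ → ℝ}
    (hw : ∀ t, 0 ≤ t → HasDerivWithinAt w (z t) (Ici 0) t)
    (hz : ∀ t, 0 ≤ t → HasDerivWithinAt z (z' t) (Ici 0) t)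
    (hz' : ∀ t, 0 ≤ t → z' t ≤ s ^ 2 * w t) (hw0 : w 0 = 0) (hz0 : z 0 = 0)
    {t : ℝ} (ht : 0 ≤ t) : w t ≤ 0 ∧ z t ≤ 0 := by
  have hsum {x : ℝ} (hx : 0 ≤ x) : z x + s * w x ≤ 0 :=
    nonpos_of_hasDerivWithinAt_le_mul s (f := fun x => z x + s * w x)
      (fun x hx => (hz x hx).add ((hw x hx).const_mul s))
      (fun x hx => by linarith [hz' x hx]) (by simp [hw0, hz0]) hx
  have hw_nonpos {x : ℝ} (hx : 0 ≤ x) : w x ≤ 0 :=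
    nonpos_of_hasDerivWithinAt_le_mul (-s) hw (fun x hx => by linarith [hsum hx]) hw0 hx
  refine ⟨hw_nonpos ht, hz0 ▸ le_initial_of_hasDerivWithinAt_nonpos hz (fun x hx => ?_) ht⟩
  exact (hz' x hx).trans (mul_nonpos_of_nonneg_of_nonpos (sq_nonneg s) (hw_nonpos hx))

/-- Grönwall-type hyperbolic comparison for a second-order differential inequality
(Lemma `sinh_ode`): if `a' = b` and `b' ≤ C·a` on `[0,∞)` with `a, b ≥ 0`, then
`a(t) ≤ a(0)·cosh(√C t) + (b(0)/√C)·sinh(√C t)` and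
`b(t) ≤ √C·(a(0)·sinh(√C t) + (b(0)/√C)·cosh(√C t))`. -/
theorem stmt_0 (C : ℝ) (hC : 0 < C) (a b b' : ℝ → ℝ)
    (ha_nonneg : ∀ t, 0 ≤ t → 0 ≤ a t) (hb_nonneg : ∀ t, 0 ≤ t → 0 ≤ b t)
    (ha_deriv : ∀ t, 0 ≤ t → HasDerivWithinAt a (b t) (Set.Ici 0) t)
    (hb_deriv : ∀ t, 0 ≤ t → HasDerivWithinAt b (b' t) (Set.Ici 0) t)
    (hb' : ∀ t, 0 ≤ t → b' t ≤ C * a t) :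
    ∀ t, 0 ≤ t →
      a t ≤ a 0 * Real.cosh (Real.sqrt C * t)
          + (b 0 / Real.sqrt C) * Real.sinh (Real.sqrt C * t) ∧
      b t ≤ Real.sqrt C * (a 0 * Real.sinh (Real.sqrt C * t)
          + (b 0 / Real.sqrt C) * Real.cosh (Real.sqrt C * t)) := by
  intro t ht
  set s := Real.sqrt C
  have hs : 0 < s := Real.sqrt_pos.2 hC
  have hsC : s ^ 2 = C := Real.sq_sqrt hC.le
  have hlin (x : ℝ) : HasDerivAt (fun x => s * x) s x := by
    simpa using (hasDerivAt_id x).const_mul s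
  have hcosh (x : ℝ) := (hlin x).cosh
  have hsinh (x : ℝ) := (hlin x).sinh
  have hA (x : ℝ) : HasDerivAt (fun x => a 0 * Real.cosh (s * x) + b 0 / s * Real.sinh (s * x))
      (s * (a 0 * Real.sinh (s * x) + b 0 / s * Real.cosh (s * x))) x :=
    (((hcosh x).const_mul (a 0)).add ((hsinh x).const_mul (b 0 / s))).congr_deriv (by ring)
  have hB (x : ℝ) : HasDerivAt
      (fun x => s * (a 0 * Real.sinh (s * x) + b 0 / s * Real.cosh (s * x)))
      (s ^ 2 * (a 0 * Real.cosh (s * x) + b 0 / s * Real.sinh (s * x))) x :=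
    ((((hsinh x).const_mul (a 0)).add ((hcosh x).const_mul (b 0 / s))).const_mul s).congr_deriv
      (by ring)
  have h := nonpos_of_second_order_le s
    (fun x hx => (ha_deriv x hx).sub (hA x).hasDerivWithinAt)
    (fun x hx => (hb_deriv x hx).sub (hB x).hasDerivWithinAt)
    (fun x hx => by
      have := hb' x hx
      rw [← hsC] at this
      simp only [Pi.sub_apply]
      linarith)
    (by simp) (by simp [mul_div_cancel₀, hs.ne']) ht
  exact ⟨sub_nonpos.1 h.1, sub_nonpos.1 h.2⟩
end

section
/- Let C > 0, D ≥ 0, E ≥ 0 and let a, b : [0,∞) → ℝ be differentiable functions with nonnegative values satisfying a(0) = 0, b(0) = 0, a'(t) = b(t) and b'(t) ≤ C·a(t) + D·t + E for all t ≥ 0. Then for all t ≥ 0: a(t) ≤ (E/C)·cosh(√C·t) + (D/C^{3/2})·sinh(√C·t) − (D/C)·t − E/C, and b(t) ≤ (E/√C)·sinh(√C·t) + (D/C)·cosh(√C·t) − D/C. -/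
/-- If `f 0 ≥ 0` and `f' ≥ c * f` on `[0, ∞)`, then `f ≥ 0` on `[0, ∞)`. -/
theorem nonneg_of_mul_le_hasDerivWithinAt {f f' : ℝ → ℝ} (c : ℝ) (h0 : 0 ≤ f 0)
    (hf : ∀ t, 0 ≤ t → HasDerivWithinAt f (f' t) (Set.Ici 0) t)
    (hle : ∀ t, 0 ≤ t → c * f t ≤ f' t) : ∀ t, 0 ≤ t → 0 ≤ f t := by
  have hg : ∀ t, 0 ≤ t → HasDerivWithinAt (fun s => Real.exp (-c * s) * f s)
      (Real.exp (-c * t) * (f' t - c * f t)) (Set.Ici 0) t := fun t ht => by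
    have hexp : HasDerivAt (fun s => Real.exp (-c * s)) (Real.exp (-c * t) * (-c)) t := by
      simpa using ((hasDerivAt_id t).const_mul (-c)).exp
    exact (hexp.hasDerivWithinAt.mul (hf t ht)).congr_deriv (by ring)
  have hmono : MonotoneOn (fun s => Real.exp (-c * s) * f s) (Set.Ici 0) := by
    refine monotoneOn_of_hasDerivWithinAt_nonneg (convex_Ici 0)
      (fun t ht => (hg t ht).continuousWithinAt)
      (fun t ht => (hg t (interior_subset ht)).mono interior_subset) fun t ht => ?_
    exact mul_nonneg (Real.exp_pos _).le (sub_nonneg.2 (hle t (interior_subset ht)))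
  intro t ht
  have h := hmono Set.self_mem_Ici ht ht
  simp only [mul_zero, Real.exp_zero, one_mul] at h
  exact nonneg_of_mul_nonneg_right (h0.trans h) (Real.exp_pos _)

/-- If `w 0 = v 0 = 0`, `w' = v` and `v' ≥ k ^ 2 * w` on `[0, ∞)`, then `w, v ≥ 0` there. -/
theorem nonneg_of_sq_mul_le_second_deriv {w v v' : ℝ → ℝ} (k : ℝ)
    (hw0 : w 0 = 0) (hv0 : v 0 = 0)
    (hw : ∀ t, 0 ≤ t → HasDerivWithinAt w (v t) (Set.Ici 0) t)
    (hv : ∀ t, 0 ≤ t → HasDerivWithinAt v (v' t) (Set.Ici 0) t)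
    (hle : ∀ t, 0 ≤ t → k ^ 2 * w t ≤ v' t) : ∀ t, 0 ≤ t → 0 ≤ w t ∧ 0 ≤ v t := by
  have hsum : ∀ t, 0 ≤ t → 0 ≤ v t + k * w t :=
    nonneg_of_mul_le_hasDerivWithinAt k (by simp [hw0, hv0])
      (fun t ht => (hv t ht).add ((hw t ht).const_mul k))
      fun t ht => by linarith [hle t ht]
  have hw_nonneg : ∀ t, 0 ≤ t → 0 ≤ w t :=
    nonneg_of_mul_le_hasDerivWithinAt (-k) hw0.ge hw fun t ht => by linarith [hsum t ht]
  have hv_nonneg : ∀ t, 0 ≤ t → 0 ≤ v t :=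
    nonneg_of_mul_le_hasDerivWithinAt 0 hv0.ge hv fun t ht => by
      linarith [hle t ht, mul_nonneg (sq_nonneg k) (hw_nonneg t ht)]
  exact fun t ht => ⟨hw_nonneg t ht, hv_nonneg t ht⟩

/-- Grönwall-type hyperbolic comparison with an affine forcing term
(Lemma `sinh_ode_with_offset`): if `a(0) = b(0) = 0`, `a' = b` and
`b' ≤ C·a + D·t + E` on `[0,∞)` with `a, b ≥ 0`, then
`a(t) ≤ (E/C)·cosh(√C t) + (D/C^{3/2})·sinh(√C t) − (D/C)·t − E/C` and
`b(t) ≤ (E/√C)·sinh(√C t) + (D/C)·cosh(√C t) − D/C`. -/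
theorem stmt_1 (C D E : ℝ) (hC : 0 < C) (hD : 0 ≤ D) (hE : 0 ≤ E) (a b b' : ℝ → ℝ)
    (ha0 : a 0 = 0) (hb0 : b 0 = 0)
    (ha_nonneg : ∀ t, 0 ≤ t → 0 ≤ a t) (hb_nonneg : ∀ t, 0 ≤ t → 0 ≤ b t)
    (ha_deriv : ∀ t, 0 ≤ t → HasDerivWithinAt a (b t) (Set.Ici 0) t)
    (hb_deriv : ∀ t, 0 ≤ t → HasDerivWithinAt b (b' t) (Set.Ici 0) t)
    (hb' : ∀ t, 0 ≤ t → b' t ≤ C * a t + D * t + E) :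
    ∀ t, 0 ≤ t →
      a t ≤ (E / C) * Real.cosh (Real.sqrt C * t)
          + (D / C ^ ((3:ℝ)/2)) * Real.sinh (Real.sqrt C * t)
          - (D / C) * t - E / C ∧
      b t ≤ (E / Real.sqrt C) * Real.sinh (Real.sqrt C * t)
          + (D / C) * Real.cosh (Real.sqrt C * t) - D / C := by
  obtain ⟨k, hk, rfl⟩ : ∃ k : ℝ, 0 < k ∧ C = k ^ 2 :=
    ⟨√C, Real.sqrt_pos.2 hC, (Real.sq_sqrt hC.le).symm⟩
  have hpow : (k ^ 2) ^ ((3 : ℝ) / 2) = k ^ 3 := by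
    rw [← Real.rpow_natCast, ← Real.rpow_mul hk.le, ← Real.rpow_natCast]
    norm_num
  rw [Real.sqrt_sq hk.le, hpow]
  have hlin : ∀ t, HasDerivAt (fun s => k * s) k t := fun t => by
    simpa using (hasDerivAt_id t).const_mul k
  have hA : ∀ t, HasDerivAt
      (fun s => E / k ^ 2 * Real.cosh (k * s) + D / k ^ 3 * Real.sinh (k * s)
        - D / k ^ 2 * s - E / k ^ 2)
      (E / k * Real.sinh (k * t) + D / k ^ 2 * Real.cosh (k * t) - D / k ^ 2) t := fun t =>
    (((((hlin t).cosh.const_mul (E / k ^ 2)).add ((hlin t).sinh.const_mul (D / k ^ 3))).sub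
      ((hasDerivAt_id t).const_mul (D / k ^ 2))).sub_const (E / k ^ 2)).congr_deriv
        (by field_simp)
  have hB : ∀ t, HasDerivAt
      (fun s => E / k * Real.sinh (k * s) + D / k ^ 2 * Real.cosh (k * s) - D / k ^ 2)
      (E * Real.cosh (k * t) + D / k * Real.sinh (k * t)) t := fun t =>
    ((((hlin t).sinh.const_mul (E / k)).add ((hlin t).cosh.const_mul (D / k ^ 2))).sub_const
      (D / k ^ 2)).congr_deriv (by field_simp)
  have key := nonneg_of_sq_mul_le_second_deriv k (by simp [ha0]) (by simp [hb0])
    (fun t ht => (hA t).hasDerivWithinAt.sub (ha_deriv t ht))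
    (fun t ht => (hB t).hasDerivWithinAt.sub (hb_deriv t ht))
    fun t ht => by
      have h : k ^ 2 * (E / k ^ 2 * Real.cosh (k * t) + D / k ^ 3 * Real.sinh (k * t)
          - D / k ^ 2 * t - E / k ^ 2)
          = E * Real.cosh (k * t) + D / k * Real.sinh (k * t) - D * t - E := by
        field_simp
      simp only [Pi.sub_apply, mul_sub] at h ⊢
      linarith [hb' t ht]
  exact fun t ht => ⟨sub_nonneg.1 (key t ht).1, sub_nonneg.1 (key t ht).2⟩
end

section
/- With the block fundamental-solution setup below, for all t ≥ 0 the following operator-norm bounds hold: ‖A(t)‖₂ ≤ cosh(√L·t), ‖B(t)‖₂ ≤ sinh(√L·t)/√L, ‖C(t)‖₂ ≤ √L·sinh(√L·t), and ‖D(t)‖₂ ≤ cosh(√L·t). -/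
/-- The operator norm of a real `d × d` matrix induced by the Euclidean norm on `ℝ^d`. -/
noncomputable def opNorm2 {d : ℕ} (A : Matrix (Fin d) (Fin d) ℝ) : ℝ :=
  ‖LinearMap.toContinuousLinearMap (Matrix.toEuclideanLin A)‖

open Set in
/-- Comparison for a cooperative second-order system: if `X' = Y` and `‖Y'‖ ≤ L ‖X‖`, then a
strict initial bound by a solution of `x' = y`, `y' = L x` persists for all times. -/
theorem norm_lt_of_cooperative_system {E : Type*} [NormedAddCommGroup E] [NormedSpace ℝ E]
    {L : ℝ} (hL : 0 < L) {X Y Y' : ℝ → E} {x y : ℝ → ℝ}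
    (hX : ∀ t, 0 ≤ t → HasDerivAt X (Y t) t) (hY : ∀ t, 0 ≤ t → HasDerivAt Y (Y' t) t)
    (hY' : ∀ t, 0 ≤ t → ‖Y' t‖ ≤ L * ‖X t‖)
    (hx : ∀ t, HasDerivAt x (y t) t) (hy : ∀ t, HasDerivAt y (L * x t) t)
    (hx0 : ‖X 0‖ < x 0) (hy0 : ‖Y 0‖ < y 0) {t : ℝ} (ht : 0 ≤ t) :
    ‖X t‖ < x t ∧ ‖Y t‖ < y t := by
  by_contra hbad
  have hXc : ContinuousOn X (Icc 0 t) := fun s hs =>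
    (hX s hs.1).continuousAt.continuousWithinAt
  have hYc : ContinuousOn Y (Icc 0 t) := fun s hs =>
    (hY s hs.1).continuousAt.continuousWithinAt
  have hxc : Continuous x := continuous_iff_continuousAt.2 fun s => (hx s).continuousAt
  have hyc : Continuous y := continuous_iff_continuousAt.2 fun s => (hy s).continuousAt
  let S : Set ℝ := {s ∈ Icc 0 t | x s ≤ ‖X s‖} ∪ {s ∈ Icc 0 t | y s ≤ ‖Y s‖}
  have hSclosed : IsClosed S :=
    (isClosed_Icc.isClosed_le hxc.continuousOn hXc.norm).union
      (isClosed_Icc.isClosed_le hyc.continuousOn hYc.norm)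
  have hSsub : S ⊆ Icc 0 t := by
    rintro s (hs | hs) <;> exact hs.1
  have hSne : S.Nonempty := by
    refine ⟨t, ?_⟩
    by_cases h : ‖X t‖ < x t
    · exact Or.inr ⟨⟨ht, le_rfl⟩, not_lt.1 fun h' => hbad ⟨h, h'⟩⟩
    · exact Or.inl ⟨⟨ht, le_rfl⟩, not_lt.1 h⟩
  have hSbdd : BddBelow S := ⟨0, fun s hs => (hSsub hs).1⟩
  set τ := sInf S
  have hτ : τ ∈ S := hSclosed.csInf_mem hSne hSbdd
  have hτI : τ ∈ Icc 0 t := hSsub hτ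
  have hbefore : ∀ s ∈ Ico 0 τ, ‖X s‖ ≤ x s ∧ ‖Y s‖ ≤ y s := by
    intro s hs
    have hsI : s ∈ Icc 0 t := ⟨hs.1, hs.2.le.trans hτI.2⟩
    constructor <;> by_contra! h
    · exact (csInf_le hSbdd (Or.inl ⟨hsI, h.le⟩)).not_gt hs.2
    · exact (csInf_le hSbdd (Or.inr ⟨hsI, h.le⟩)).not_gt hs.2
  have hsub : Icc 0 τ ⊆ Icc 0 t := Icc_subset_Icc_right hτI.2
  have h1 := image_norm_le_of_norm_deriv_right_le_deriv_boundary (hXc.mono hsub)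
    (fun s hs => (hX s hs.1).hasDerivWithinAt) (B := fun s => x s - (x 0 - ‖X 0‖)) (by simp)
    (fun s => (hx s).sub_const _) (fun s hs => (hbefore s hs).2) ⟨hτI.1, le_rfl⟩
  have h2 := image_norm_le_of_norm_deriv_right_le_deriv_boundary (hYc.mono hsub)
    (fun s hs => (hY s hs.1).hasDerivWithinAt) (B := fun s => y s - (y 0 - ‖Y 0‖)) (by simp)
    (fun s => (hy s).sub_const _)
    (fun s hs => (hY' s hs.1).trans (mul_le_mul_of_nonneg_left (hbefore s hs).1 hL.le))
    ⟨hτI.1, le_rfl⟩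
  rcases hτ with h | h
  · linarith [h.2]
  · linarith [h.2]

/-- Non-strict version of `norm_lt_of_cooperative_system`. -/
theorem norm_le_of_cooperative_system {E : Type*} [NormedAddCommGroup E] [NormedSpace ℝ E]
    {L : ℝ} (hL : 0 < L) {X Y Y' : ℝ → E} {x y : ℝ → ℝ}
    (hX : ∀ t, 0 ≤ t → HasDerivAt X (Y t) t) (hY : ∀ t, 0 ≤ t → HasDerivAt Y (Y' t) t)
    (hY' : ∀ t, 0 ≤ t → ‖Y' t‖ ≤ L * ‖X t‖)
    (hx : ∀ t, HasDerivAt x (y t) t) (hy : ∀ t, HasDerivAt y (L * x t) t)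
    (hx0 : ‖X 0‖ ≤ x 0) (hy0 : ‖Y 0‖ ≤ y 0) {t : ℝ} (ht : 0 ≤ t) :
    ‖X t‖ ≤ x t ∧ ‖Y t‖ ≤ y t := by
  have hw : 0 < √L := Real.sqrt_pos.2 hL
  have hww : √L * √L = L := Real.mul_self_sqrt hL.le
  have hexp : ∀ s, HasDerivAt (fun s => Real.exp (√L * s)) (√L * Real.exp (√L * s)) s := by
    intro s
    simpa [mul_comm] using ((hasDerivAt_id s).const_mul √L).exp
  have key : ∀ ε > 0, ‖X t‖ < x t + ε * Real.exp (√L * t) ∧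
      ‖Y t‖ < y t + ε * (√L * Real.exp (√L * t)) := by
    intro ε hε
    refine norm_lt_of_cooperative_system hL hX hY hY'
      (x := fun s => x s + ε * Real.exp (√L * s))
      (y := fun s => y s + ε * (√L * Real.exp (√L * s)))
      (fun s => (hx s).add ((hexp s).const_mul ε)) (fun s => ?_) ?_ ?_ ht
    · refine ((hy s).add (((hexp s).const_mul √L).const_mul ε)).congr_deriv ?_
      rw [← mul_assoc √L, hww]
      ring
    · simpa using hx0.trans_lt (lt_add_of_pos_right _ hε)
    · simpa using hy0.trans_lt (lt_add_of_pos_right _ (mul_pos hε hw))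
  constructor <;> refine le_of_forall_pos_le_add fun δ hδ => ?_
  · have hc := Real.exp_pos (√L * t)
    have := (key (δ / Real.exp (√L * t)) (div_pos hδ hc)).1
    rw [div_mul_cancel₀ _ hc.ne'] at this
    exact this.le
  · have hc := mul_pos hw (Real.exp_pos (√L * t))
    have := (key (δ / (√L * Real.exp (√L * t))) (div_pos hδ hc)).2
    rw [div_mul_cancel₀ _ hc.ne'] at this
    exact this.le

theorem opNorm2_eq_norm_toEuclideanCLM {d : ℕ} (A : Matrix (Fin d) (Fin d) ℝ) :
    opNorm2 A = ‖Matrix.toEuclideanCLM (𝕜 := ℝ) A‖ := rfl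

theorem hasDerivAt_linearMap_of_entries {d : ℕ} {E : Type*} [NormedAddCommGroup E]
    [NormedSpace ℝ E] (Φ : Matrix (Fin d) (Fin d) ℝ →ₗ[ℝ] E)
    {A : ℝ → Matrix (Fin d) (Fin d) ℝ} {A' : Matrix (Fin d) (Fin d) ℝ} {t : ℝ}
    (h : ∀ i j, HasDerivAt (fun s => A s i j) (A' i j) t) :
    HasDerivAt (fun s => Φ (A s)) (Φ A') t := by
  have hΦ : ∀ N : Matrix (Fin d) (Fin d) ℝ,
      Φ N = ∑ i, ∑ j, N i j • Φ (Matrix.single i j 1) := by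
    intro N
    conv_lhs => rw [Matrix.matrix_eq_sum_single N]
    simp only [map_sum, ← map_smul, Matrix.smul_single, smul_eq_mul, mul_one]
  rw [hΦ A', funext fun s => hΦ (A s)]
  exact HasDerivAt.fun_sum fun i _ => HasDerivAt.fun_sum fun j _ => (h i j).smul_const _

/-- Comparison for `X' = Y`, `Y' = M X` in terms of the entries of the matrices. -/
theorem opNorm2_le_of_cooperative_system {d : ℕ} {L : ℝ} (hL : 0 < L)
    {M X Y : ℝ → Matrix (Fin d) (Fin d) ℝ} (hM : ∀ t, 0 ≤ t → opNorm2 (M t) ≤ L)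
    (hX : ∀ t, 0 ≤ t → ∀ i j, HasDerivAt (fun s => X s i j) (Y t i j) t)
    (hY : ∀ t, 0 ≤ t → ∀ i j, HasDerivAt (fun s => Y s i j) ((M t * X t) i j) t)
    {x y : ℝ → ℝ} (hx : ∀ t, HasDerivAt x (y t) t) (hy : ∀ t, HasDerivAt y (L * x t) t)
    (hx0 : opNorm2 (X 0) ≤ x 0) (hy0 : opNorm2 (Y 0) ≤ y 0) {t : ℝ} (ht : 0 ≤ t) :
    opNorm2 (X t) ≤ x t ∧ opNorm2 (Y t) ≤ y t := by
  let Φ : Matrix (Fin d) (Fin d) ℝ →ₗ[ℝ] _ :=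
    (Matrix.toEuclideanCLM (n := Fin d) (𝕜 := ℝ)).toAlgEquiv.toLinearMap
  refine norm_le_of_cooperative_system hL (X := fun s => Φ (X s)) (Y := fun s => Φ (Y s))
    (Y' := fun s => Φ (M s * X s)) (fun s hs => hasDerivAt_linearMap_of_entries Φ (hX s hs))
    (fun s hs => hasDerivAt_linearMap_of_entries Φ (hY s hs)) (fun s hs => ?_) hx hy hx0 hy0 ht
  calc ‖Matrix.toEuclideanCLM (𝕜 := ℝ) (M s * X s)‖
      ≤ ‖Matrix.toEuclideanCLM (𝕜 := ℝ) (M s)‖ * ‖Matrix.toEuclideanCLM (𝕜 := ℝ) (X s)‖ := by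
        rw [map_mul]
        exact norm_mul_le _ _
    _ ≤ L * ‖Matrix.toEuclideanCLM (𝕜 := ℝ) (X s)‖ :=
        mul_le_mul_of_nonneg_right (hM s hs) (norm_nonneg _)

theorem opNorm2_zero {d : ℕ} : opNorm2 (0 : Matrix (Fin d) (Fin d) ℝ) = 0 := by
  rw [opNorm2_eq_norm_toEuclideanCLM, map_zero, norm_zero]

theorem opNorm2_one_le {d : ℕ} : opNorm2 (1 : Matrix (Fin d) (Fin d) ℝ) ≤ 1 := by
  rw [opNorm2_eq_norm_toEuclideanCLM, map_one]
  exact ContinuousLinearMap.norm_id_le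

/-- Lemma `matrix-exponent-block-bounds`, first set of bounds: for the block
fundamental solution `[[A,B],[C,D]]` of `[[0,I],[M(t),0]]` with `‖M(t)‖₂ ≤ L`,
one has `‖A(t)‖₂ ≤ cosh(√L t)`, `‖B(t)‖₂ ≤ sinh(√L t)/√L`,
`‖C(t)‖₂ ≤ √L·sinh(√L t)` and `‖D(t)‖₂ ≤ cosh(√L t)` for all `t ≥ 0`. -/
theorem stmt_4 (d : ℕ) (L : ℝ) (hL : 0 < L)
    (M : ℝ → Matrix (Fin d) (Fin d) ℝ) (hMcont : Continuous M)
    (hMbound : ∀ t, 0 ≤ t → opNorm2 (M t) ≤ L)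
    (A B C D : ℝ → Matrix (Fin d) (Fin d) ℝ)
    (hA0 : A 0 = 1) (hB0 : B 0 = 0) (hC0 : C 0 = 0) (hD0 : D 0 = 1)
    (hA : ∀ t, 0 ≤ t → ∀ i j, HasDerivAt (fun s => A s i j) (C t i j) t)
    (hB : ∀ t, 0 ≤ t → ∀ i j, HasDerivAt (fun s => B s i j) (D t i j) t)
    (hC : ∀ t, 0 ≤ t → ∀ i j, HasDerivAt (fun s => C s i j) ((M t * A t) i j) t)
    (hD : ∀ t, 0 ≤ t → ∀ i j, HasDerivAt (fun s => D s i j) ((M t * B t) i j) t) :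
    ∀ t, 0 ≤ t →
      opNorm2 (A t) ≤ Real.cosh (Real.sqrt L * t) ∧
      opNorm2 (B t) ≤ Real.sinh (Real.sqrt L * t) / Real.sqrt L ∧
      opNorm2 (C t) ≤ Real.sqrt L * Real.sinh (Real.sqrt L * t) ∧
      opNorm2 (D t) ≤ Real.cosh (Real.sqrt L * t) := by
  have hw : 0 < √L := Real.sqrt_pos.2 hL
  have hww : √L * √L = L := Real.mul_self_sqrt hL.le
  have hcosh : ∀ s, HasDerivAt (fun s => Real.cosh (√L * s)) (√L * Real.sinh (√L * s)) s := by
    intro s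
    simpa [mul_comm] using ((hasDerivAt_id s).const_mul √L).cosh
  have hsinh : ∀ s, HasDerivAt (fun s => Real.sinh (√L * s)) (√L * Real.cosh (√L * s)) s := by
    intro s
    simpa [mul_comm] using ((hasDerivAt_id s).const_mul √L).sinh
  intro t ht
  have hAC := opNorm2_le_of_cooperative_system hL hMbound hA hC hcosh
    (fun s => ((hsinh s).const_mul √L).congr_deriv (by rw [← mul_assoc, hww]))
    (by simpa [hA0] using opNorm2_one_le) (by simp [hC0, opNorm2_zero]) ht
  have hBD := opNorm2_le_of_cooperative_system hL hMbound hB hD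
    (x := fun s => Real.sinh (√L * s) / √L)
    (fun s => ((hsinh s).div_const √L).congr_deriv (mul_div_cancel_left₀ _ hw.ne'))
    (fun s => (hcosh s).congr_deriv (by
      rw [mul_div_assoc', eq_div_iff hw.ne', mul_right_comm, hww]))
    (by simp [hB0, opNorm2_zero]) (by simpa [hD0] using opNorm2_one_le) ht
  exact ⟨hAC.1, hBD.1, hAC.2, hBD.2⟩
end

section
/- Let d ∈ ℕ and let A be a d×d real matrix with ‖A‖₂ < 1/4. Then det(I + A) > 0 and the following three bounds hold: |log det(I + A) − (tr(A) − tr(A²)/2)| ≤ 2d·‖A‖₂³, |log det(I + A) − tr(A)| ≤ 2d·‖A‖₂², and |log det(I + A)| ≤ 2d·‖A‖₂. -/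
open Polynomial in
/-- For a complex matrix, `det (w + B)` is the product of `w + z` over the eigenvalues `z`. -/
lemma Matrix.det_smul_one_add_eq_prod_roots_charpoly {n : Type*} [Fintype n] [DecidableEq n]
    (B : Matrix n n ℂ) (w : ℂ) :
    (w • 1 + B).det = (B.charpoly.roots.map (fun z => w + z)).prod := by
  have hsplit := (IsAlgClosed.splits B.charpoly)
  have hcard : B.charpoly.roots.card = Fintype.card n := by
    rw [← hsplit.natDegree_eq_card_roots, B.charpoly_natDegree_eq_dim]
  have h1 : B.charpoly.eval (-w) = (-1) ^ Fintype.card n * (w • 1 + B).det := by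
    rw [Matrix.eval_charpoly, ← Matrix.det_neg]
    congr 1
    ext i j
    by_cases h : i = j <;> simp [h]
    ring
  have h2 : B.charpoly.eval (-w) =
      (-1) ^ Fintype.card n * (B.charpoly.roots.map (fun z => w + z)).prod := by
    rw [hsplit.eval_eq_prod_roots_of_monic B.charpoly_monic, ← hcard,
      ← Multiset.card_map (fun z => w + z), ← Multiset.prod_map_neg, Multiset.map_map]
    congr 1
    refine Multiset.map_congr rfl fun z _ => ?_
    simp only [Function.comp_apply]
    ring
  exact mul_left_cancel₀ (pow_ne_zero _ (neg_ne_zero.mpr one_ne_zero)) (h1.symm.trans h2)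

open Polynomial in
/-- The trace of the square of a complex matrix is the sum of the squares of its eigenvalues. -/
lemma Matrix.trace_mul_self_eq_sum_sq_roots_charpoly {n : Type*} [Fintype n] [DecidableEq n]
    (B : Matrix n n ℂ) :
    (B * B).trace = (B.charpoly.roots.map (fun z => z ^ 2)).sum := by
  have hchar : (B * B).charpoly =
      ((B.charpoly.roots.map (fun z => z ^ 2)).map (fun a => X - C a)).prod := by
    refine Polynomial.funext fun x => ?_
    obtain ⟨w, rfl⟩ : ∃ w : ℂ, w ^ 2 = x := IsAlgClosed.exists_pow_nat_eq x two_pos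
    have hfac : Matrix.scalar n (w ^ 2) - B * B =
        (Matrix.scalar n w - B) * (w • 1 + B) := by
      rw [Matrix.scalar_apply, Matrix.scalar_apply, ← Matrix.smul_one_eq_diagonal,
        ← Matrix.smul_one_eq_diagonal]
      simp only [sub_mul, mul_add, smul_mul_assoc, mul_smul_comm, one_mul, mul_one, smul_sub,
        smul_smul, pow_two]
      abel
    rw [Matrix.eval_charpoly, hfac, Matrix.det_mul, ← Matrix.eval_charpoly,
      Matrix.det_smul_one_add_eq_prod_roots_charpoly,
      (IsAlgClosed.splits B.charpoly).eval_eq_prod_roots_of_monic B.charpoly_monic,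
      ← Multiset.prod_map_mul, Polynomial.eval_multiset_prod, Multiset.map_map, Multiset.map_map]
    congr 1
    refine Multiset.map_congr rfl fun z _ => ?_
    simp only [Function.comp_apply, eval_sub, eval_X, eval_C]
    ring
  rw [Matrix.trace_eq_sum_roots_charpoly, hchar, Polynomial.roots_multiset_prod_X_sub_C]

lemma norm_toEuclideanLin_le_opNorm2 {d : ℕ} (A : Matrix (Fin d) (Fin d) ℝ)
    (x : EuclideanSpace ℝ (Fin d)) :
    ‖Matrix.toEuclideanLin A x‖ ≤ opNorm2 A * ‖x‖ :=
  (LinearMap.toContinuousLinearMap (Matrix.toEuclideanLin A)).le_opNorm x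

lemma opNorm2_nonneg {d : ℕ} (A : Matrix (Fin d) (Fin d) ℝ) : 0 ≤ opNorm2 A := norm_nonneg _

lemma sum_sq_mulVec_le {d : ℕ} (A : Matrix (Fin d) (Fin d) ℝ) (x : Fin d → ℝ) :
    ∑ i, (A.mulVec x) i ^ 2 ≤ opNorm2 A ^ 2 * ∑ i, x i ^ 2 := by
  have h := pow_le_pow_left₀ (norm_nonneg _)
    (norm_toEuclideanLin_le_opNorm2 A (WithLp.toLp 2 x)) 2
  rw [mul_pow, EuclideanSpace.norm_sq_eq, EuclideanSpace.norm_sq_eq] at h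
  simpa using h

/-- The complex eigenvalues of a real matrix are bounded by its operator norm. -/
lemma norm_le_opNorm2_of_mem_roots_charpoly {d : ℕ} (A : Matrix (Fin d) (Fin d) ℝ) {z : ℂ}
    (hz : z ∈ (A.map Complex.ofReal).charpoly.roots) : ‖z‖ ≤ opNorm2 A := by
  have hroot := (Polynomial.mem_roots'.mp hz).2
  rw [Polynomial.IsRoot, Matrix.eval_charpoly] at hroot
  obtain ⟨v, hv, hv0⟩ := Matrix.exists_mulVec_eq_zero_iff.mpr hroot
  have heig : (A.map Complex.ofReal).mulVec v = z • v := by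
    rw [Matrix.sub_mulVec, sub_eq_zero, Matrix.scalar_apply, ← Matrix.smul_one_eq_diagonal,
      Matrix.smul_mulVec, Matrix.one_mulVec] at hv0
    exact hv0.symm
  have hre (i) : (A.mulVec fun j => (v j).re) i = (z * v i).re := by
    have := congrArg Complex.re (congrFun heig i)
    simpa [Matrix.mulVec, dotProduct] using this
  have him (i) : (A.mulVec fun j => (v j).im) i = (z * v i).im := by
    have := congrArg Complex.im (congrFun heig i)
    simpa [Matrix.mulVec, dotProduct] using this
  have hbound := add_le_add (sum_sq_mulVec_le A fun j => (v j).re)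
    (sum_sq_mulVec_le A fun j => (v j).im)
  simp only [hre, him] at hbound
  rw [← mul_add, ← Finset.sum_add_distrib, ← Finset.sum_add_distrib] at hbound
  have hsq (w : ℂ) : w.re ^ 2 + w.im ^ 2 = ‖w‖ ^ 2 := by
    rw [← Complex.normSq_eq_norm_sq, Complex.normSq_apply]
    ring
  simp only [hsq, norm_mul, mul_pow] at hbound
  rw [← Finset.mul_sum] at hbound
  obtain ⟨i, hi⟩ := Function.ne_iff.mp hv
  have hpos : 0 < ∑ i, ‖v i‖ ^ 2 :=
    Finset.sum_pos' (fun _ _ => sq_nonneg _)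
      ⟨i, Finset.mem_univ i, pow_pos (norm_pos_iff.mpr hi) 2⟩
  exact (sq_le_sq₀ (norm_nonneg z) (opNorm2_nonneg A)).mp (le_of_mul_le_mul_right hbound hpos)

lemma det_one_add_smul_ne_zero {d : ℕ} (A : Matrix (Fin d) (Fin d) ℝ) (hA : opNorm2 A < 1)
    {t : ℝ} (ht : t ∈ Set.Icc (0 : ℝ) 1) : (1 + t • A).det ≠ 0 := by
  intro h0
  obtain ⟨v, hv, hv0⟩ := Matrix.exists_mulVec_eq_zero_iff.mpr h0
  rw [Matrix.add_mulVec, Matrix.one_mulVec, Matrix.smul_mulVec] at hv0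
  have hcoord (i) : v i ^ 2 ≤ (A.mulVec v) i ^ 2 := by
    have h1 : v i = -(t * (A.mulVec v) i) := by
      have := congrFun hv0 i
      simp only [Pi.add_apply, Pi.smul_apply, smul_eq_mul, Pi.zero_apply] at this
      linarith
    rw [h1, neg_sq, mul_pow]
    exact mul_le_of_le_one_left (sq_nonneg _) (pow_le_one₀ ht.1 ht.2)
  have hle := (Finset.sum_le_sum fun i _ => hcoord i).trans (sum_sq_mulVec_le A v)
  obtain ⟨i, hi⟩ := Function.ne_iff.mp hv
  have hpos : 0 < ∑ i, v i ^ 2 :=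
    Finset.sum_pos' (fun _ _ => sq_nonneg _) ⟨i, Finset.mem_univ i, sq_pos_of_ne_zero hi⟩
  have hlt : opNorm2 A ^ 2 < 1 := pow_lt_one₀ (opNorm2_nonneg A) hA two_ne_zero
  nlinarith

lemma det_one_add_pos {d : ℕ} (A : Matrix (Fin d) (Fin d) ℝ) (hA : opNorm2 A < 1) :
    0 < (1 + A).det := by
  by_contra! hneg
  have hcont : Continuous fun t : ℝ => (1 + t • A).det := by fun_prop
  obtain ⟨t, ht, h0⟩ := intermediate_value_Icc' (zero_le_one' ℝ) hcont.continuousOn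
    (show (0 : ℝ) ∈ _ by simpa using hneg)
  exact det_one_add_smul_ne_zero A hA ht h0

lemma norm_multiset_sum_sub_le {s : Multiset ℂ} {f g : ℂ → ℂ} {c : ℝ}
    (h : ∀ z ∈ s, ‖f z - g z‖ ≤ c) :
    ‖(s.map f).sum - (s.map g).sum‖ ≤ s.card * c := by
  rw [← Multiset.sum_map_sub, ← nsmul_eq_mul, ← Multiset.card_map (fun z => ‖f z - g z‖) s]
  refine (norm_multiset_sum_le _).trans ?_
  rw [Multiset.map_map]
  exact Multiset.sum_le_card_nsmul _ _ (by simpa using h)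

/-- The logarithm of `|∏ (1 + z)|` is the real part of the sum of the complex logarithms. -/
lemma log_norm_prod_one_add {s : Multiset ℂ} (h : ∀ z ∈ s, 1 + z ≠ 0) :
    Real.log ‖(s.map fun z => 1 + z).prod‖ = (s.map fun z => Complex.log (1 + z)).sum.re := by
  induction s using Multiset.induction_on with
  | empty => simp
  | cons a s ih =>
    have hs : ∀ z ∈ s, 1 + z ≠ 0 := fun z hz => h z (Multiset.mem_cons_of_mem hz)
    have hprod : (s.map fun z => 1 + z).prod ≠ 0 := by
      simpa [Multiset.prod_eq_zero_iff] using hs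
    rw [Multiset.map_cons, Multiset.prod_cons, norm_mul,
      Real.log_mul (norm_ne_zero_iff.mpr (h a (Multiset.mem_cons_self a s)))
        (norm_ne_zero_iff.mpr hprod), ih hs]
    simp [Complex.log_re]

/-- A pointwise approximation of `log (1 + z)` on the disc of radius `opNorm2 A` approximates
`log (det (1 + A))` by a sum over the complex eigenvalues of `A`. -/
lemma abs_log_det_one_add_sub_le {d : ℕ} (A : Matrix (Fin d) (Fin d) ℝ) (hA : opNorm2 A < 1)
    {g : ℂ → ℂ} {c : ℝ} (h : ∀ z : ℂ, ‖z‖ ≤ opNorm2 A → ‖Complex.log (1 + z) - g z‖ ≤ c) :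
    |Real.log (1 + A).det - (((A.map Complex.ofReal).charpoly.roots.map g).sum).re| ≤ d * c := by
  set s := (A.map Complex.ofReal).charpoly.roots with hs
  have hmem : ∀ z ∈ s, ‖z‖ ≤ opNorm2 A := fun z => norm_le_opNorm2_of_mem_roots_charpoly A
  have hcard : s.card = d := by
    rw [hs, ← (IsAlgClosed.splits _).natDegree_eq_card_roots, Matrix.charpoly_natDegree_eq_dim,
      Fintype.card_fin]
  have hdet : (((1 + A).det : ℝ) : ℂ) = (s.map fun z => 1 + z).prod := by
    rw [← Matrix.det_smul_one_add_eq_prod_roots_charpoly, one_smul]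
    refine (Complex.ofRealHom.map_det (1 + A)).trans ?_
    rw [map_add, map_one]
    rfl
  have hne : ∀ z ∈ s, 1 + z ≠ 0 := fun z hz => Complex.slitPlane_ne_zero
    (Complex.mem_slitPlane_of_norm_lt_one ((hmem z hz).trans_lt hA))
  have hlog : Real.log (1 + A).det = (s.map fun z => Complex.log (1 + z)).sum.re := by
    rw [← log_norm_prod_one_add hne, ← hdet, Complex.norm_real, Real.norm_eq_abs, Real.log_abs]
  rw [hlog, ← Complex.sub_re, ← hcard]
  exact (Complex.abs_re_le_norm _).trans (norm_multiset_sum_sub_le fun z hz => h z (hmem z hz))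

lemma trace_eq_re_sum_roots_charpoly {d : ℕ} (A : Matrix (Fin d) (Fin d) ℝ) :
    A.trace = ((A.map Complex.ofReal).charpoly.roots.sum).re := by
  rw [← Matrix.trace_eq_sum_roots_charpoly]
  simp [Matrix.trace]

lemma trace_mul_self_eq_re_sum_sq_roots_charpoly {d : ℕ} (A : Matrix (Fin d) (Fin d) ℝ) :
    (A * A).trace = (((A.map Complex.ofReal).charpoly.roots.map fun z => z ^ 2).sum).re := by
  rw [← Matrix.trace_mul_self_eq_sum_sq_roots_charpoly]
  simp [Matrix.trace, Matrix.mul_apply]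

/-- Taylor remainder of `log (1 + z)` on a disc of radius less than `1 / 4`. -/
lemma norm_log_one_add_sub_logTaylor_le {r : ℝ} (hr : r < 1 / 4) (n : ℕ) {z : ℂ} (hz : ‖z‖ ≤ r) :
    ‖Complex.log (1 + z) - Complex.logTaylor (n + 1) z‖ ≤ 2 * r ^ (n + 1) := by
  have hr0 := (norm_nonneg z).trans hz
  refine (Complex.norm_log_sub_logTaylor_le n (by linarith)).trans ?_
  have hinv0 : 0 ≤ (1 - ‖z‖)⁻¹ := inv_nonneg.mpr (by linarith)
  have hinv : (1 - ‖z‖)⁻¹ ≤ 2 := inv_le_of_inv_le₀ two_pos (by linarith)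
  calc ‖z‖ ^ (n + 1) * (1 - ‖z‖)⁻¹ / (n + 1)
      ≤ ‖z‖ ^ (n + 1) * (1 - ‖z‖)⁻¹ := div_le_self (by positivity) (by simp)
    _ ≤ r ^ (n + 1) * 2 := by gcongr
    _ = 2 * r ^ (n + 1) := mul_comm _ _

/-- Lemma `taylor_determinant_inverse`: if `‖A‖₂ < 1/4` then `det(I + A) > 0` and
`|log det(I+A) − (tr A − tr(A²)/2)| ≤ 2d‖A‖₂³`,
`|log det(I+A) − tr A| ≤ 2d‖A‖₂²`, and `|log det(I+A)| ≤ 2d‖A‖₂`. -/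
theorem stmt_7 (d : ℕ) (A : Matrix (Fin d) (Fin d) ℝ) (hA : opNorm2 A < 1/4) :
    0 < (1 + A).det ∧
    |Real.log (1 + A).det - (A.trace - (A * A).trace / 2)| ≤ 2 * d * opNorm2 A ^ 3 ∧
    |Real.log (1 + A).det - A.trace| ≤ 2 * d * opNorm2 A ^ 2 ∧
    |Real.log (1 + A).det| ≤ 2 * d * opNorm2 A := by
  have hA1 : opNorm2 A < 1 := by linarith
  have key (n : ℕ) := abs_log_det_one_add_sub_le A hA1
    fun z hz => norm_log_one_add_sub_logTaylor_le hA n hz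
  have taylor1 : Complex.logTaylor 1 = fun _ => 0 := by
    funext z
    simp [Complex.logTaylor]
  have taylor2 : Complex.logTaylor 2 = fun z => z := by
    funext z
    simp [Complex.logTaylor, Finset.sum_range_succ]
  have taylor3 : Complex.logTaylor 3 = fun z => z - z ^ 2 / 2 := by
    funext z
    simp [Complex.logTaylor, Finset.sum_range_succ]
    ring
  refine ⟨det_one_add_pos A hA1, ?_, ?_, ?_⟩
  · have h := key 2
    rw [taylor3, Multiset.sum_map_sub, Multiset.sum_map_div, Multiset.map_id',
      Complex.sub_re, Complex.div_ofNat_re, ← trace_eq_re_sum_roots_charpoly,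
      ← trace_mul_self_eq_re_sum_sq_roots_charpoly] at h
    linarith
  · have h := key 1
    rw [taylor2, Multiset.map_id', ← trace_eq_re_sum_roots_charpoly] at h
    norm_num at h
    linarith
  · have h := key 0
    simp only [zero_add, taylor1, Multiset.map_const', Multiset.sum_replicate, smul_zero,
      Complex.zero_re, sub_zero, pow_one] at h
    linarith
end

section
/- Let X be a real random variable with E[X] = 0 and suppose there is α with 0 ≤ α ≤ 1/2 such that |X| ≤ α almost surely. Then |E[e^X] − e^{E[X²]/2}| ≤ 8α³. -/
open MeasureTheory

theorem abs_exp_sub_quadratic_le {x : ℝ} (hx : |x| ≤ 1) :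
    |Real.exp x - (1 + x + x ^ 2 / 2)| ≤ |x| ^ 3 := by
  have h := Real.exp_bound hx (n := 3) (by norm_num)
  norm_num [Finset.sum_range_succ, Nat.factorial] at h
  exact h.trans (mul_le_of_le_one_right (by positivity) (by norm_num))

/-- Lemma `symmetrization`: if `X` is a centered real random variable with
`|X| ≤ α ≤ 1/2` almost surely, then `|E[e^X] − e^{E[X²]/2}| ≤ 8α³`. -/
theorem stmt_8 {Ω : Type*} [MeasurableSpace Ω] (P : Measure Ω) [IsProbabilityMeasure P]
    (X : Ω → ℝ) (hX : Measurable X)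
    (hmean : ∫ ω, X ω ∂P = 0)
    (α : ℝ) (hα0 : 0 ≤ α) (hα : α ≤ 1/2)
    (hbound : ∀ᵐ ω ∂P, |X ω| ≤ α) :
    |(∫ ω, Real.exp (X ω) ∂P) - Real.exp ((∫ ω, (X ω) ^ 2 ∂P) / 2)| ≤ 8 * α ^ 3 := by
  have hsq_bound : ∀ᵐ ω ∂P, ‖X ω ^ 2‖ ≤ α ^ 2 := by
    filter_upwards [hbound] with ω h
    simpa using pow_le_pow_left₀ (abs_nonneg _) h 2
  have hX_int : Integrable X P := .of_bound hX.aestronglyMeasurable α hbound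
  have hsq_int : Integrable (fun ω => X ω ^ 2) P :=
    .of_bound (hX.pow_const 2).aestronglyMeasurable (α ^ 2) hsq_bound
  have hexp_int : Integrable (fun ω => Real.exp (X ω)) P := by
    refine .of_bound hX.exp.aestronglyMeasurable (Real.exp α) ?_
    filter_upwards [hbound] with ω h
    simpa using (le_abs_self _).trans h
  set s := ∫ ω, X ω ^ 2 ∂P with hs
  have hs0 : 0 ≤ s := integral_nonneg fun ω => sq_nonneg _
  have hsα : s ≤ α ^ 2 := by
    simpa using (le_abs_self s).trans (norm_integral_le_of_norm_le_const hsq_bound)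
  have hquad : ∫ ω, (Real.exp (X ω) - (1 + X ω + X ω ^ 2 / 2)) ∂P
      = (∫ ω, Real.exp (X ω) ∂P) - (1 + s / 2) := by
    have h1 : Integrable (fun ω => 1 + X ω) P := (integrable_const 1).add hX_int
    have h2 : Integrable (fun ω => 1 + X ω + X ω ^ 2 / 2) P := h1.add (hsq_int.div_const 2)
    rw [integral_sub hexp_int h2,
      integral_add h1 (hsq_int.div_const 2), integral_add (integrable_const 1) hX_int,
      integral_div, hmean]
    simp [hs]
  have hexpX : |(∫ ω, Real.exp (X ω) ∂P) - (1 + s / 2)| ≤ α ^ 3 := by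
    rw [← hquad]
    have h : ∀ᵐ ω ∂P, ‖Real.exp (X ω) - (1 + X ω + X ω ^ 2 / 2)‖ ≤ α ^ 3 := by
      filter_upwards [hbound] with ω h
      exact (abs_exp_sub_quadratic_le (by linarith)).trans
        (pow_le_pow_left₀ (abs_nonneg _) h 3)
    simpa using norm_integral_le_of_norm_le_const h
  have hα2 : α ^ 2 ≤ 1 := by nlinarith
  have hexps : |Real.exp (s / 2) - 1 - s / 2| ≤ (s / 2) ^ 2 :=
    Real.abs_exp_sub_one_sub_id_le (by rw [abs_of_nonneg (by positivity)]; linarith)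
  have hs2 : (s / 2) ^ 2 ≤ α ^ 3 := by
    have h1 : s ^ 2 ≤ (α ^ 2) ^ 2 := pow_le_pow_left₀ hs0 hsα 2
    have h2 : α ^ 3 * α ≤ α ^ 3 := mul_le_of_le_one_right (by positivity) (by linarith)
    nlinarith [sq_nonneg s]
  have hα3 : 0 ≤ α ^ 3 := by positivity
  rw [abs_le] at hexpX hexps ⊢
  constructor <;> linarith
end

section
/- Let (Ω, 𝓕, P) be a probability space with a filtration (𝓕_j)_{j≥0}, let δ > 0 and L > 0, and let (H_j)_{j≥0} be ℝ^d-valued random vectors with H_j 𝓕_{j+1}-measurable, E[H_j | 𝓕_j] = 0, and ‖H_j‖ ≤ L almost surely for every j. Define u_0 = 0 and u_{j+1} = u_j + √δ·H_j. Then for every integer k ≥ 1: E[ exp( ‖u_k‖² / (8kδL²) ) ] ≤ 2. -/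
open MeasureTheory

lemma abs_mul_sinh_div_le {x y : ℝ} (h : |x| ≤ y) : |x * (Real.sinh y / y)| ≤ Real.sinh y := by
  have hy : 0 ≤ y := (abs_nonneg x).trans h
  have hs : 0 ≤ Real.sinh y := Real.sinh_nonneg_iff.2 hy
  rw [abs_mul, abs_of_nonneg (div_nonneg hs hy)]
  calc |x| * (Real.sinh y / y) ≤ y * (Real.sinh y / y) := by gcongr
    _ ≤ Real.sinh y := by
      rcases hy.eq_or_lt with rfl | hy
      · simp
      · rw [mul_div_cancel₀ _ hy.ne']

/-- The chord bound for the exponential on `[-y, y]`. -/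
lemma exp_le_cosh_add_mul_sinh_div {x y : ℝ} (h : |x| ≤ y) :
    Real.exp x ≤ Real.cosh y + x * (Real.sinh y / y) := by
  have hy : 0 ≤ y := (abs_nonneg x).trans h
  rcases hy.eq_or_lt with rfl | hy
  · simp [abs_nonpos_iff.1 h]
  obtain ⟨h1, h2⟩ := abs_le.1 h
  have ha : 0 ≤ (y + x) / (2 * y) := div_nonneg (by linarith) (by linarith)
  have hb : 0 ≤ (y - x) / (2 * y) := div_nonneg (by linarith) (by linarith)
  have hab : (y + x) / (2 * y) + (y - x) / (2 * y) = 1 := by field_simp; ring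
  have := convexOn_exp.2 (Set.mem_univ y) (Set.mem_univ (-y)) ha hb hab
  simp only [smul_eq_mul] at this
  calc Real.exp x = Real.exp ((y + x) / (2 * y) * y + (y - x) / (2 * y) * -y) := by
        congr 1; field_simp; ring
    _ ≤ _ := this
    _ = _ := by rw [Real.cosh_eq, Real.sinh_eq]; field_simp; ring

/-- One-step bound for the square-exponential moment of a martingale with bounded increments. -/
lemma integral_exp_mul_norm_add_sq_le {Ω E : Type*} {m m0 : MeasurableSpace Ω} {P : Measure Ω}
    [IsProbabilityMeasure P] [NormedAddCommGroup E] [InnerProductSpace ℝ E] [CompleteSpace E]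
    (hm : m ≤ m0) {v h : Ω → E} {a M R : ℝ} (ha : 0 ≤ a)
    (hv : StronglyMeasurable[m] v) (hvR : ∀ᵐ ω ∂P, ‖v ω‖ ≤ R)
    (hh : AEStronglyMeasurable h P) (hhM : ∀ᵐ ω ∂P, ‖h ω‖ ≤ M) (hmean : P[h | m] =ᵐ[P] 0) :
    ∫ ω, Real.exp (a * ‖v ω + h ω‖ ^ 2) ∂P ≤
      Real.exp (a * M ^ 2) * ∫ ω, Real.exp ((a + 2 * a ^ 2 * M ^ 2) * ‖v ω‖ ^ 2) ∂P := by
  let y : Ω → ℝ := fun ω ↦ 2 * a * ‖v ω‖ * M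
  let W : Ω → E := fun ω ↦
    (Real.exp (a * ‖v ω‖ ^ 2) * (2 * a * (Real.sinh (y ω) / y ω))) • v ω
  have hvm : Measurable[m] fun ω ↦ ‖v ω‖ := hv.norm.measurable
  have hW : StronglyMeasurable[m] W := by
    refine StronglyMeasurable.smul (Measurable.stronglyMeasurable ?_) hv
    have hy : Measurable[m] y := (hvm.const_mul _).mul_const _
    exact (Real.measurable_exp.comp ((hvm.pow_const 2).const_mul a)).mul
      (((Real.measurable_sinh.comp hy).div hy).const_mul (2 * a))
  have hWh : ∀ ω, inner ℝ (W ω) (h ω) = Real.exp (a * ‖v ω‖ ^ 2) *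
      (2 * a * inner ℝ (v ω) (h ω) * (Real.sinh (y ω) / y ω)) := fun ω ↦ by
    simp only [W, real_inner_smul_left]; ring
  have hxy : ∀ᵐ ω ∂P, |2 * a * inner ℝ (v ω) (h ω)| ≤ y ω := by
    filter_upwards [hhM] with ω hω
    rw [abs_mul, abs_of_nonneg (by positivity : 0 ≤ 2 * a)]
    calc 2 * a * |inner ℝ (v ω) (h ω)| ≤ 2 * a * (‖v ω‖ * ‖h ω‖) := by
          gcongr; exact abs_real_inner_le_norm _ _
      _ ≤ 2 * a * (‖v ω‖ * M) := by gcongr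
      _ = y ω := by simp only [y]; ring
  have hM : 0 ≤ M := by
    obtain ⟨ω, hω⟩ := hhM.exists
    exact (norm_nonneg _).trans hω
  have hhint : Integrable h P := .of_bound hh M hhM
  have hv' : AEStronglyMeasurable v P := (hv.mono hm).aestronglyMeasurable
  have hWint : Integrable (fun ω ↦ inner ℝ (W ω) (h ω)) P := by
    refine .of_bound ((hW.mono hm).aestronglyMeasurable.inner hh)
      (Real.exp (a * R ^ 2) * Real.sinh (2 * a * R * M)) ?_
    filter_upwards [hxy, hvR] with ω hω hR
    rw [hWh, Real.norm_eq_abs, abs_mul, Real.abs_exp]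
    have : y ω ≤ 2 * a * R * M := by simp only [y]; gcongr
    gcongr
    exact (abs_mul_sinh_div_le hω).trans (Real.sinh_le_sinh.2 this)
  have hWzero : ∫ ω, inner ℝ (W ω) (h ω) ∂P = 0 := by
    rw [← integral_condExp hm]
    refine integral_eq_zero_of_ae ?_
    filter_upwards [condExp_bilin_of_stronglyMeasurable_left (innerSL ℝ) hW hWint hhint, hmean]
      with ω h1 h2
    refine h1.trans ?_
    simp [h2]
  have hexp : ∀ (c : ℝ) (R' : ℝ) (w : Ω → E), 0 ≤ c → AEStronglyMeasurable w P →
      (∀ᵐ ω ∂P, ‖w ω‖ ≤ R') → Integrable (fun ω ↦ Real.exp (c * ‖w ω‖ ^ 2)) P := by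
    intro c R' w hc hw hwR
    refine .of_bound (Real.continuous_exp.comp_aestronglyMeasurable
      ((hw.norm.pow 2).const_mul c)) (Real.exp (c * R' ^ 2)) ?_
    filter_upwards [hwR] with ω hω
    rw [Real.norm_eq_abs, Real.abs_exp]
    gcongr
  have hvint := hexp (a + 2 * a ^ 2 * M ^ 2) R v (by positivity) hv' hvR
  calc ∫ ω, Real.exp (a * ‖v ω + h ω‖ ^ 2) ∂P
      ≤ ∫ ω, Real.exp (a * M ^ 2) * (Real.exp ((a + 2 * a ^ 2 * M ^ 2) * ‖v ω‖ ^ 2)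
          + inner ℝ (W ω) (h ω)) ∂P := by
        refine integral_mono_ae (hexp a (R + M) (fun ω ↦ v ω + h ω) ha (hv'.add hh) ?_)
          ((hvint.add hWint).const_mul _) ?_
        · filter_upwards [hvR, hhM] with ω h1 h2
          exact (norm_add_le _ _).trans (add_le_add h1 h2)
        filter_upwards [hxy, hhM] with ω hω hM'
        have hsq : a * ‖v ω + h ω‖ ^ 2 = a * ‖h ω‖ ^ 2 +
            (a * ‖v ω‖ ^ 2 + 2 * a * inner ℝ (v ω) (h ω)) := by
          rw [norm_add_sq_real]; ring
        have hcosh : Real.exp (a * ‖v ω‖ ^ 2) * Real.cosh (y ω) ≤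
            Real.exp ((a + 2 * a ^ 2 * M ^ 2) * ‖v ω‖ ^ 2) := by
          calc _ ≤ Real.exp (a * ‖v ω‖ ^ 2) * Real.exp (y ω ^ 2 / 2) := by
                gcongr; exact Real.cosh_le_exp_half_sq _
            _ = _ := by rw [← Real.exp_add]; congr 1; simp only [y]; ring
        rw [hsq, Real.exp_add, Real.exp_add, hWh]
        gcongr
        calc _ ≤ Real.exp (a * ‖v ω‖ ^ 2) * (Real.cosh (y ω) +
              2 * a * inner ℝ (v ω) (h ω) * (Real.sinh (y ω) / y ω)) := by
              gcongr; exact exp_le_cosh_add_mul_sinh_div hω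
          _ ≤ _ := by rw [mul_add]; gcongr
    _ = _ := by
        rw [integral_const_mul, integral_add hvint hWint, hWzero, add_zero]

/-- Lemma `clt_submartingale_tail`: for a martingale-increment process
`u_{j+1} = u_j + √δ·H_j` in `ℝ^d` with `u_0 = 0`, conditionally centered
increments `H_j` bounded by `L` a.s., one has
`E[exp(‖u_k‖²/(8kδL²))] ≤ 2` for every `k ≥ 1`. -/
theorem stmt_14 {Ω : Type*} {m0 : MeasurableSpace Ω} (P : Measure Ω)
    [IsProbabilityMeasure P] (F : Filtration ℕ m0)
    (d : ℕ) (δ L : ℝ) (hδ : 0 < δ) (hL : 0 < L)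
    (H : ℕ → Ω → EuclideanSpace ℝ (Fin d))
    (hH_meas : ∀ j, StronglyMeasurable[F (j + 1)] (H j))
    (hH_bound : ∀ j, ∀ᵐ ω ∂P, ‖H j ω‖ ≤ L)
    (hH_mean : ∀ j, P[H j | F j] =ᵐ[P] 0)
    (u : ℕ → Ω → EuclideanSpace ℝ (Fin d))
    (hu0 : ∀ ω, u 0 ω = 0)
    (hu : ∀ j ω, u (j + 1) ω = u j ω + Real.sqrt δ • H j ω) :
    ∀ k : ℕ, 1 ≤ k →
      (∫ ω, Real.exp (‖u k ω‖ ^ 2 / (8 * k * δ * L ^ 2)) ∂P) ≤ 2 := by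
  intro k hk
  set M : ℝ := Real.sqrt δ * L with hM
  have hMpos : 0 < M := by positivity
  have hM2 : M ^ 2 = δ * L ^ 2 := by rw [hM, mul_pow, Real.sq_sqrt hδ.le]
  have hk' : (1 : ℝ) ≤ k := by exact_mod_cast hk
  have hhM : ∀ j, ∀ᵐ ω ∂P, ‖Real.sqrt δ • H j ω‖ ≤ M := fun j ↦ by
    filter_upwards [hH_bound j] with ω hω
    rw [norm_smul, Real.norm_of_nonneg (Real.sqrt_nonneg δ)]
    exact mul_le_mul_of_nonneg_left hω (Real.sqrt_nonneg δ)
  have hmeas : ∀ j, StronglyMeasurable[F j] (u j) := by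
    intro j
    induction j with
    | zero => rw [show u 0 = fun _ ↦ 0 from funext hu0]; exact stronglyMeasurable_const
    | succ j ih =>
      rw [show u (j + 1) = fun ω ↦ u j ω + Real.sqrt δ • H j ω from funext (hu j)]
      exact (ih.mono (F.mono j.le_succ)).add ((hH_meas j).fun_const_smul _)
  have hbdd : ∀ j : ℕ, ∀ᵐ ω ∂P, ‖u j ω‖ ≤ j * M := by
    intro j
    induction j with
    | zero => simp [hu0]
    | succ j ih =>
      filter_upwards [ih, hhM j] with ω h1 h2
      rw [hu]
      push_cast
      linarith [norm_add_le (u j ω) (Real.sqrt δ • H j ω)]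
  have key : ∀ j : ℕ, ∫ ω, Real.exp (1 / ((6 * k + 2 * j) * M ^ 2) * ‖u j ω‖ ^ 2) ∂P ≤
      Real.exp (j / (6 * k)) := by
    intro j
    induction j with
    | zero => simp [hu0]
    | succ j ih =>
      set a : ℝ := 1 / ((6 * k + 2 * (j + 1 : ℕ)) * M ^ 2) with ha
      have ha0 : 0 ≤ a := by positivity
      have haM : a * M ^ 2 ≤ 1 / (6 * k) := by
        rw [ha, one_div, mul_inv, mul_assoc, inv_mul_cancel₀ (by positivity), mul_one, ← one_div]
        gcongr
        exact le_add_of_nonneg_right (by positivity)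
      have haa : a + 2 * a ^ 2 * M ^ 2 ≤ 1 / ((6 * k + 2 * j) * M ^ 2) := by
        have hn : (0 : ℝ) < 6 * k + 2 * j := by positivity
        rw [ha, show (6 * k + 2 * (j + 1 : ℕ) : ℝ) = 6 * k + 2 * j + 2 by push_cast; ring]
        generalize (6 * k + 2 * j : ℝ) = n at hn
        calc _ = (n + 4) / ((n + 2) ^ 2 * M ^ 2) := by field_simp; ring
          _ ≤ 1 / (n * M ^ 2) := by
            rw [div_le_div_iff₀ (by positivity) (by positivity)]
            nlinarith [sq_nonneg M]
      have hmean : P[fun ω ↦ Real.sqrt δ • H j ω | F j] =ᵐ[P] 0 := by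
        filter_upwards [condExp_smul (μ := P) (Real.sqrt δ) (H j) (F j), hH_mean j] with ω h1 h2
        refine h1.trans ?_
        simp [h2]
      have hstep := integral_exp_mul_norm_add_sq_le (F.le j) ha0 (hmeas j) (hbdd j)
        (((hH_meas j).mono (F.le _)).const_smul (Real.sqrt δ)).aestronglyMeasurable (hhM j) hmean
      simp_rw [hu]
      refine hstep.trans ?_
      rw [show ((j + 1 : ℕ) : ℝ) / (6 * k) = 1 / (6 * k) + j / (6 * k) by push_cast; ring,
        Real.exp_add]
      gcongr
      refine le_trans (integral_mono_of_nonneg (.of_forall fun ω ↦ (Real.exp_pos _).le) ?_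
        (.of_forall fun ω ↦ ?_)) ih
      · refine .of_bound (Real.continuous_exp.comp_aestronglyMeasurable
          (((((hmeas j).mono (F.le j)).aestronglyMeasurable).norm.pow 2).const_mul _))
          (Real.exp (1 / ((6 * k + 2 * j) * M ^ 2) * (j * M) ^ 2)) ?_
        filter_upwards [hbdd j] with ω hω
        rw [Real.norm_eq_abs, Real.abs_exp]
        gcongr
      · dsimp only
        gcongr
  have h6 : Real.exp (k / (6 * k)) ≤ 2 := by
    rw [show (k : ℝ) / (6 * k) = 1 / 6 by field_simp, ← Real.le_log_iff_exp_le two_pos]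
    linarith [Real.log_two_gt_d9]
  refine le_trans (le_of_eq ?_) ((key k).trans h6)
  congr 1 with ω
  congr 1
  rw [hM2]
  field_simp
  ring
end

section
/- Let d ∈ ℕ, L_R > 0, L_H > 0, L_H' > 0, and let H : ℝ^d → ℝ^d satisfy ‖H(u)‖ ≤ L_H for every u ∈ ℝ^d and be continuously differentiable on the closed ball {u : ‖u‖ ≤ 1/(2√L_R)} with ‖DH(u)‖ ≤ L_H' there. Let δ satisfy 0 < δ ≤ min{ 1/(16·L_R·L_H²), 1/(16·L_H'²) } and define G(u) = u + √δ·H(u). Then for every x ∈ ℝ^d with ‖x‖ ≤ 1/(4√L_R), there exists a unique u ∈ ℝ^d with G(u) = x, and this u satisfies ‖u‖ ≤ 1/(2√L_R). -/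
/-- A map that sends the whole space into a nonempty complete set on which it is a contraction
has exactly one fixed point. -/
theorem existsUnique_fixedPoint_of_forall_mem {X : Type*} [MetricSpace X] {s : Set X}
    (hs : IsComplete s) (hne : s.Nonempty) {f : X → X} (hf : ∀ u, f u ∈ s) {K : NNReal}
    (hK : K < 1) (hLip : LipschitzOnWith K f s) : ∃! u, f u = u := by
  have hmaps : Set.MapsTo f s s := fun u _ => hf u
  obtain ⟨a, ha⟩ := hne
  have hc : ContractingWith K (hmaps.restrict f s s) := ⟨hK, hLip.mapsToRestrict hmaps⟩
  obtain ⟨u, -, hu, -⟩ := hc.exists_fixedPoint' hs hmaps ha (edist_ne_top _ _)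
  refine ⟨u, hu, fun v hv => ?_⟩
  have hus : u ∈ s := hu ▸ hf u
  have hvs : v ∈ s := hv ▸ hf v
  have huv : (⟨v, hvs⟩ : s) = ⟨u, hus⟩ :=
    hc.fixedPoint_unique' (Subtype.ext hv) (Subtype.ext hu)
  exact congrArg Subtype.val huv

/-- A bound `δ ≤ 1 / (16 a²)` yields `√δ a ≤ 1 / 4`. -/
theorem sqrt_mul_le_quarter {δ a : ℝ} (ha : 0 < a) (h : δ ≤ 1 / (16 * a ^ 2)) :
    √δ * a ≤ 1 / 4 := by
  have h1 : √δ ≤ 1 / (4 * a) := by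
    refine Real.sqrt_le_iff.mpr ⟨by positivity, h.trans_eq ?_⟩
    field_simp
    norm_num
  calc √δ * a ≤ 1 / (4 * a) * a := by gcongr
    _ = 1 / 4 := by field_simp

/-- Lemma `G_is_invertible`: if `‖H(u)‖ ≤ L_H` everywhere, `H` is continuously
differentiable on the closed ball of radius `1/(2√L_R)` with `‖DH‖ ≤ L_H'` there,
and `0 < δ ≤ min(1/(16 L_R L_H²), 1/(16 L_H'²))`, then for every `x` with
`‖x‖ ≤ 1/(4√L_R)` the equation `G(u) = u + √δ·H(u) = x` has a unique solution,
and this solution satisfies `‖u‖ ≤ 1/(2√L_R)`. -/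
theorem stmt_16 (d : ℕ) (LR LH LH' : ℝ) (hLR : 0 < LR) (hLH : 0 < LH) (hLH' : 0 < LH')
    (H : EuclideanSpace ℝ (Fin d) → EuclideanSpace ℝ (Fin d))
    (hH_bound : ∀ u, ‖H u‖ ≤ LH)
    (H' : EuclideanSpace ℝ (Fin d) →
      (EuclideanSpace ℝ (Fin d) →L[ℝ] EuclideanSpace ℝ (Fin d)))
    (hH_deriv : ∀ u ∈ Metric.closedBall (0 : EuclideanSpace ℝ (Fin d))
        (1 / (2 * Real.sqrt LR)),
      HasFDerivWithinAt H (H' u) (Metric.closedBall 0 (1 / (2 * Real.sqrt LR))) u)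
    (hH'_cont : ContinuousOn H' (Metric.closedBall 0 (1 / (2 * Real.sqrt LR))))
    (hH'_bound : ∀ u ∈ Metric.closedBall (0 : EuclideanSpace ℝ (Fin d))
        (1 / (2 * Real.sqrt LR)), ‖H' u‖ ≤ LH')
    (δ : ℝ) (hδ : 0 < δ)
    (hδle : δ ≤ min (1 / (16 * LR * LH ^ 2)) (1 / (16 * LH' ^ 2))) :
    ∀ x : EuclideanSpace ℝ (Fin d), ‖x‖ ≤ 1 / (4 * Real.sqrt LR) →
      (∃! u, u + Real.sqrt δ • H u = x) ∧
      (∀ u, u + Real.sqrt δ • H u = x → ‖u‖ ≤ 1 / (2 * Real.sqrt LR)) := by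
  intro x hx
  set s := Metric.closedBall (0 : EuclideanSpace ℝ (Fin d)) (1 / (2 * √LR))
  have hr : 0 < √LR := Real.sqrt_pos.mpr hLR
  have hδH' : √δ * LH' ≤ 1 / 4 := sqrt_mul_le_quarter hLH' (hδle.trans (min_le_right _ _))
  have hδH : √δ * LH ≤ 1 / (4 * √LR) := by
    have h : √δ * (√LR * LH) ≤ 1 / 4 := by
      refine sqrt_mul_le_quarter (by positivity) ((hδle.trans (min_le_left _ _)).trans_eq ?_)
      rw [mul_pow, Real.sq_sqrt hLR.le, mul_assoc]
    rw [le_div_iff₀ (by positivity)]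
    linarith
  have hmem : ∀ u, x - √δ • H u ∈ s := fun u => by
    rw [mem_closedBall_zero_iff]
    calc ‖x - √δ • H u‖ ≤ ‖x‖ + ‖√δ • H u‖ := norm_sub_le _ _
      _ = ‖x‖ + √δ * ‖H u‖ := by rw [norm_smul, Real.norm_of_nonneg (Real.sqrt_nonneg δ)]
      _ ≤ ‖x‖ + √δ * LH := by gcongr; exact hH_bound u
      _ ≤ 1 / (4 * √LR) + 1 / (4 * √LR) := add_le_add hx hδH
      _ = 1 / (2 * √LR) := by field_simp; norm_num
  have hLip : LipschitzOnWith (1 / 4) (fun u => x - √δ • H u) s := by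
    refine LipschitzOnWith.of_dist_le_mul fun u hu v hv => ?_
    have hmv : ‖H u - H v‖ ≤ LH' * ‖u - v‖ :=
      (convex_closedBall _ _).norm_image_sub_le_of_norm_hasFDerivWithin_le hH_deriv hH'_bound hv hu
    rw [dist_sub_left, dist_smul₀, Real.norm_of_nonneg (Real.sqrt_nonneg δ), dist_eq_norm,
      dist_eq_norm]
    calc √δ * ‖H u - H v‖ ≤ √δ * (LH' * ‖u - v‖) := by gcongr
      _ = √δ * LH' * ‖u - v‖ := by ring
      _ ≤ 1 / 4 * ‖u - v‖ := by gcongr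
      _ = ((1 / 4 : NNReal) : ℝ) * ‖u - v‖ := by push_cast; rfl
  have hiff : ∀ u, u + √δ • H u = x ↔ x - √δ • H u = u := fun u => by
    rw [sub_eq_iff_eq_add, eq_comm]
  refine ⟨?_, fun u hu => ?_⟩
  · simp only [hiff]
    exact existsUnique_fixedPoint_of_forall_mem Metric.isClosed_closedBall.isComplete
      ⟨_, hmem 0⟩ hmem (by rw [← NNReal.coe_lt_coe]; norm_num) hLip
  · have h := hmem u
    rwa [(hiff u).mp hu, mem_closedBall_zero_iff] at h
end

section
/- With the setup below, let û ∈ ℝ^d satisfy ‖û‖ ≤ 1/(4√L_R), and let u ∈ ℝ^d be a point with ‖u‖ ≤ 1/(2√L_R) and G(u) = û. Then: (i) ‖u − û‖ ≤ √δ·L_H; (ii) ‖u − (û − √δ·H(û))‖ ≤ δ·L_H'·L_H; (iii) ‖u − (û − √δ·H(û) + δ·DH(û)(H(û)))‖ ≤ δ^{3/2}·( L_H''·L_H² + L_H'²·L_H ). -/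
/-- First-order Taylor estimate on a convex set, with a bound on the second derivative. -/
theorem Convex.norm_image_sub_sub_fderiv_le {E F : Type*}
    [NormedAddCommGroup E] [NormedSpace ℝ E] [NormedAddCommGroup F] [NormedSpace ℝ F]
    {s : Set E} (hs : Convex ℝ s) {f : E → F} {f' : E → E →L[ℝ] F} {f'' : E → E →L[ℝ] E →L[ℝ] F}
    {C : ℝ} (hf : ∀ x ∈ s, HasFDerivWithinAt f (f' x) s x)
    (hf' : ∀ x ∈ s, HasFDerivWithinAt f' (f'' x) s x) (hC : ∀ x ∈ s, ‖f'' x‖ ≤ C)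
    {x y : E} (hx : x ∈ s) (hy : y ∈ s) :
    ‖f y - f x - f' x (y - x)‖ ≤ C * ‖y - x‖ ^ 2 := by
  have hsub : segment ℝ x y ⊆ s := hs.segment_subset hx hy
  have hC0 : 0 ≤ C := (norm_nonneg (f'' x)).trans (hC x hx)
  have key : ∀ z ∈ segment ℝ x y, ‖f' z - f' x‖ ≤ C * ‖y - x‖ := by
    intro z hz
    refine (hs.norm_image_sub_le_of_norm_hasFDerivWithin_le hf' hC hx (hsub hz)).trans ?_
    gcongr
    exact norm_sub_le_of_mem_segment hz
  have := (convex_segment x y).norm_image_sub_le_of_norm_hasFDerivWithin_le'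
    (fun z hz => (hf z (hsub hz)).mono hsub) key
    (left_mem_segment ℝ x y) (right_mem_segment ℝ x y)
  exact this.trans_eq (by ring)


/-- Lemma `taylor_u_ut`: with `G(u) = u + √δ·H(u)`, `‖uhat‖ ≤ 1/(4√L_R)`, and `u`
in the ball of radius `1/(2√L_R)` with `G(u) = uhat`, one has the Taylor-type bounds
`‖u − uhat‖ ≤ √δ·L_H`, `‖u − (uhat − √δ·H(uhat))‖ ≤ δ·L_H'·L_H`, and
`‖u − (uhat − √δ·H(uhat) + δ·DH(uhat)(H(uhat)))‖ ≤ δ^{3/2}·(L_H''·L_H² + L_H'²·L_H)`. -/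
theorem stmt_17 (d : ℕ) (LR LH LH' LH'' : ℝ)
    (hLR : 0 < LR) (hLH : 0 < LH) (hLH' : 0 < LH') (hLH'' : 0 < LH'')
    (H : EuclideanSpace ℝ (Fin d) → EuclideanSpace ℝ (Fin d))
    (hH_bound : ∀ u, ‖H u‖ ≤ LH)
    (H' : EuclideanSpace ℝ (Fin d) →
      (EuclideanSpace ℝ (Fin d) →L[ℝ] EuclideanSpace ℝ (Fin d)))
    (H'' : EuclideanSpace ℝ (Fin d) →
      (EuclideanSpace ℝ (Fin d) →L[ℝ]
        EuclideanSpace ℝ (Fin d) →L[ℝ] EuclideanSpace ℝ (Fin d)))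
    (hH_deriv : ∀ u ∈ Metric.closedBall (0 : EuclideanSpace ℝ (Fin d))
        (1 / (2 * Real.sqrt LR)),
      HasFDerivWithinAt H (H' u) (Metric.closedBall 0 (1 / (2 * Real.sqrt LR))) u)
    (hH'_deriv : ∀ u ∈ Metric.closedBall (0 : EuclideanSpace ℝ (Fin d))
        (1 / (2 * Real.sqrt LR)),
      HasFDerivWithinAt H' (H'' u) (Metric.closedBall 0 (1 / (2 * Real.sqrt LR))) u)
    (hH''_cont : ContinuousOn H'' (Metric.closedBall 0 (1 / (2 * Real.sqrt LR))))
    (hH'_bound : ∀ u ∈ Metric.closedBall (0 : EuclideanSpace ℝ (Fin d))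
        (1 / (2 * Real.sqrt LR)), ‖H' u‖ ≤ LH')
    (hH''_bound : ∀ u ∈ Metric.closedBall (0 : EuclideanSpace ℝ (Fin d))
        (1 / (2 * Real.sqrt LR)), ‖H'' u‖ ≤ LH'')
    (δ : ℝ) (hδ : 0 < δ)
    (hδle : δ ≤ min (1 / (16 * LR * LH ^ 2)) (1 / (16 * LH' ^ 2)))
    (uhat u : EuclideanSpace ℝ (Fin d))
    (huhat : ‖uhat‖ ≤ 1 / (4 * Real.sqrt LR))
    (hu_ball : ‖u‖ ≤ 1 / (2 * Real.sqrt LR))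
    (hu : u + Real.sqrt δ • H u = uhat) :
    ‖u - uhat‖ ≤ Real.sqrt δ * LH ∧
    ‖u - (uhat - Real.sqrt δ • H uhat)‖ ≤ δ * LH' * LH ∧
    ‖u - (uhat - Real.sqrt δ • H uhat + δ • (H' uhat) (H uhat))‖ ≤
      δ ^ ((3:ℝ)/2) * (LH'' * LH ^ 2 + LH' ^ 2 * LH) := by
  set B : Set (EuclideanSpace ℝ (Fin d)) := Metric.closedBall 0 (1 / (2 * Real.sqrt LR)) with hB
  have hconv : Convex ℝ B := convex_closedBall _ _
  have hsq : 0 < Real.sqrt LR := Real.sqrt_pos.mpr hLR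
  have huB : u ∈ B := by simpa [hB] using hu_ball
  have huhatB : uhat ∈ B := by
    rw [hB, mem_closedBall_zero_iff]
    refine huhat.trans (one_div_le_one_div_of_le (by positivity) (by linarith))
  have hpow : δ ^ ((3:ℝ)/2) = δ * Real.sqrt δ := by
    rw [Real.sqrt_eq_rpow, show ((3:ℝ)/2) = 1 + 1 / 2 by norm_num, Real.rpow_add hδ,
      Real.rpow_one]
  have hss : Real.sqrt δ * Real.sqrt δ = δ := Real.mul_self_sqrt hδ.le
  rw [hpow]
  set s := Real.sqrt δ
  have hs0 : 0 ≤ s := Real.sqrt_nonneg δ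
  have hdiff : u - uhat = -(s • H u) := by rw [← hu]; abel
  have h1 : ‖u - uhat‖ ≤ s * LH := by
    rw [hdiff, norm_neg, norm_smul, Real.norm_of_nonneg hs0]
    exact mul_le_mul_of_nonneg_left (hH_bound u) hs0
  have hlip : ‖H u - H uhat‖ ≤ LH' * (s * LH) :=
    (hconv.norm_image_sub_le_of_norm_hasFDerivWithin_le hH_deriv hH'_bound huhatB huB).trans
      (mul_le_mul_of_nonneg_left h1 hLH'.le)
  have htaylor : ‖H u - H uhat - H' uhat (u - uhat)‖ ≤ LH'' * (s * LH) ^ 2 :=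
    (hconv.norm_image_sub_sub_fderiv_le hH_deriv hH'_deriv hH''_bound huhatB huB).trans
      (by gcongr)
  refine ⟨h1, ?_, ?_⟩
  · have e : u - (uhat - s • H uhat) = -(s • (H u - H uhat)) := by
      rw [← sub_add, hdiff, smul_sub]; abel
    rw [e, norm_neg, norm_smul, Real.norm_of_nonneg hs0]
    calc s * ‖H u - H uhat‖ ≤ s * (LH' * (s * LH)) := by gcongr
      _ = (s * s) * LH' * LH := by ring
      _ = δ * LH' * LH := by rw [hss]
  · have e : u - (uhat - s • H uhat + δ • (H' uhat) (H uhat)) =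
        δ • H' uhat (H u - H uhat) - s • (H u - H uhat - H' uhat (u - uhat)) := by
      have : u - (uhat - s • H uhat + δ • (H' uhat) (H uhat)) =
        (u - uhat) + s • H uhat - δ • (H' uhat) (H uhat) := by abel
      rw [this, hdiff, ← hss]
      simp only [map_sub, map_neg, map_smul, smul_sub, smul_neg, mul_smul]
      abel
    rw [e]
    calc _ ≤ ‖δ • H' uhat (H u - H uhat)‖ + ‖s • (H u - H uhat - H' uhat (u - uhat))‖ :=
          norm_sub_le _ _
      _ ≤ δ * (LH' * (LH' * (s * LH))) + s * (LH'' * (s * LH) ^ 2) := by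
          rw [norm_smul, norm_smul, Real.norm_of_nonneg hs0, Real.norm_of_nonneg hδ.le]
          gcongr
          exact (H' uhat).le_of_opNorm_le_of_le (hH'_bound uhat huhatB) hlip
      _ = δ * (LH' * (LH' * (s * LH))) + s * (LH'' * ((s * s) * LH ^ 2)) := by ring
      _ = δ * s * (LH'' * LH ^ 2 + LH' ^ 2 * LH) := by rw [hss]; ring
end

section
/- Let (Ω, 𝓕, P) be a probability space, d ∈ ℕ, û ∈ ℝ^d, and let H : Ω × ℝ^d → ℝ^d be jointly measurable. Suppose there are r > 0 and constants L, L', L'' > 0 such that for every ω, the map z ↦ H(ω, z) is twice continuously differentiable on the open ball B(û, r) with ‖H(ω,z)‖ ≤ L, ‖D_zH(ω,z)‖ ≤ L' and ‖D_z²H(ω,z)‖ ≤ L'' for all z ∈ B(û, r), and suppose that for every z ∈ B(û, r): E[H(z)] = 0 and E[H(z)·H(z)ᵀ] = I. Then, writing H^i, ∂_j for coordinates and partial derivatives in z at the point û: (1) for every index i, Σ_j E[ ∂_jH^i(û)·H^j(û) ] + Σ_j E[ ∂_jH^j(û)·H^i(û) ] = 0 (equivalently, E[ DH(û)·H(û)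 + tr(DH(û))·H(û) ] = 0); and (2) E[ 2·Σ_{i,j} ∂_i∂_jH^i(û)·H^j(û) + Σ_{i,j} ∂_jH^i(û)·∂_iH^j(û) + Σ_{i,j} ∂_iH^i(û)·∂_jH^j(û) ] = 0. -/
open MeasureTheory

section LineDerivIntegral

open Filter Topology

variable {Ω E : Type*} [MeasurableSpace Ω] {P : Measure Ω}
  [NormedAddCommGroup E] [NormedSpace ℝ E] {S : Set E} {x v : E}

theorem eventually_add_smul_mem (hS : IsOpen S) (hx : x ∈ S) (v : E) :
    ∀ᶠ t : ℝ in 𝓝 0, x + t • v ∈ S := by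
  have hc : Continuous fun t : ℝ => x + t • v := by fun_prop
  exact hc.continuousAt.eventually (hS.mem_nhds (by simpa using hx))

/-- A line derivative depends measurably on the parameter if the function does. -/
theorem aestronglyMeasurable_of_hasLineDerivAt {f : Ω → E → ℝ} {f' : Ω → ℝ}
    (hS : IsOpen S) (hx : x ∈ S)
    (hf : ∀ y ∈ S, AEStronglyMeasurable (fun ω => f ω y) P)
    (hf' : ∀ ω, HasLineDerivAt ℝ (f ω) (f' ω) x v) :
    AEStronglyMeasurable f' P := by
  have hev : ∀ᶠ t : ℝ in 𝓝[≠] 0, x + t • v ∈ S :=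
    (eventually_add_smul_mem hS hx v).filter_mono nhdsWithin_le_nhds
  obtain ⟨t, ht, htS⟩ := exists_seq_forall_of_frequently hev.frequently
  refine aestronglyMeasurable_of_tendsto_ae atTop
    (f := fun n ω => (t n)⁻¹ • (f ω (x + t n • v) - f ω x))
    (fun n => ((hf _ (htS n)).sub (hf x hx)).const_smul (t n)⁻¹)
    (Eventually.of_forall fun ω => (hf' ω).tendsto_slope_zero.comp ht)

/-- If the mean of a random function is constant on an open set, then the mean of its line
derivative vanishes there. -/
theorem integral_lineDeriv_eq_zero [IsFiniteMeasure P] {f f' : Ω → E → ℝ} {c C C' : ℝ}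
    (hS : IsOpen S)
    (hf : ∀ y ∈ S, AEStronglyMeasurable (fun ω => f ω y) P)
    (hf_bound : ∀ ω, ∀ y ∈ S, ‖f ω y‖ ≤ C)
    (hf'_bound : ∀ ω, ∀ y ∈ S, ‖f' ω y‖ ≤ C')
    (hf' : ∀ ω, ∀ y ∈ S, HasLineDerivAt ℝ (f ω) (f' ω y) y v)
    (hc : ∀ y ∈ S, ∫ ω, f ω y ∂P = c) (hx : x ∈ S) :
    Integrable (fun ω => f' ω x) P ∧ ∫ ω, f' ω x ∂P = 0 := by
  have hev := eventually_add_smul_mem hS hx v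
  have key := hasDerivAt_integral_of_dominated_loc_of_deriv_le (μ := P) (x₀ := (0 : ℝ))
    (F := fun t ω => f ω (x + t • v)) (F' := fun t ω => f' ω (x + t • v))
    (s := {t | x + t • v ∈ S}) (bound := fun _ => C') hev
    (hev.mono fun t ht => hf _ ht)
    (by simpa using Integrable.of_bound (hf x hx) C (ae_of_all _ fun ω => hf_bound ω x hx))
    (by simpa using aestronglyMeasurable_of_hasLineDerivAt hS hx hf fun ω => hf' ω x hx)
    (ae_of_all _ fun ω t ht => hf'_bound ω _ ht) (integrable_const _)
    (ae_of_all _ fun ω t ht => by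
      have h := hf' ω _ ht
      rw [HasLineDerivAt, ← sub_self t] at h
      simpa [add_assoc, ← add_smul] using h.comp_sub_const t t)
  simp only [zero_smul, add_zero] at key
  exact ⟨key.1, key.2.unique ((hasDerivAt_const (0 : ℝ) c).congr_of_eventuallyEq
    (hev.mono fun t ht => hc _ ht))⟩

theorem HasLineDerivAt.mul_real {f g : E → ℝ} {f' g' : ℝ}
    (hf : HasLineDerivAt ℝ f f' x v) (hg : HasLineDerivAt ℝ g g' x v) :
    HasLineDerivAt ℝ (fun y => f y * g y) (f' * g x + f x * g') x v := by
  simpa [HasLineDerivAt] using HasDerivAt.fun_mul hf hg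

theorem HasLineDerivAt.euclidean_apply {d : ℕ} {f : E → EuclideanSpace ℝ (Fin d)}
    {f' : EuclideanSpace ℝ (Fin d)} (hf : HasLineDerivAt ℝ f f' x v) (i : Fin d) :
    HasLineDerivAt ℝ (fun y => f y i) (f' i) x v :=
  (EuclideanSpace.proj (𝕜 := ℝ) i).hasFDerivAt.comp_hasDerivAt _ hf

end LineDerivIntegral

theorem norm_mul_le_of_norm_le {a b A B : ℝ} (ha : ‖a‖ ≤ A) (hb : ‖b‖ ≤ B) :
    ‖a * b‖ ≤ A * B :=
  (norm_mul_le a b).trans (mul_le_mul ha hb (norm_nonneg b) ((norm_nonneg a).trans ha))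

/-- Lemma `cancellations_due_to_constant_covariance`: if the random field `H`
satisfies `E[H(z)] = 0` and `E[H(z)H(z)ᵀ] = I` for all `z` in a ball around `uhat`,
and is (uniformly boundedly) twice continuously differentiable there, then
(1) `E[DH(uhat)·H(uhat) + tr(DH(uhat))·H(uhat)] = 0` coordinatewise, and
(2) `E[2·Σᵢⱼ ∂ᵢ∂ⱼHⁱ·Hʲ + Σᵢⱼ ∂ⱼHⁱ·∂ᵢHʲ + Σᵢⱼ ∂ᵢHⁱ·∂ⱼHʲ] = 0` at `uhat`. -/
theorem stmt_19 {Ω : Type*} [MeasurableSpace Ω] (P : Measure Ω)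
    [IsProbabilityMeasure P]
    (d : ℕ) (uhat : EuclideanSpace ℝ (Fin d))
    (H : Ω → EuclideanSpace ℝ (Fin d) → EuclideanSpace ℝ (Fin d))
    (hH_meas : Measurable (Function.uncurry H))
    (r L L' L'' : ℝ) (hr : 0 < r) (hL : 0 < L) (hL' : 0 < L') (hL'' : 0 < L'')
    (DH : Ω → EuclideanSpace ℝ (Fin d) →
      (EuclideanSpace ℝ (Fin d) →L[ℝ] EuclideanSpace ℝ (Fin d)))
    (D2H : Ω → EuclideanSpace ℝ (Fin d) →
      (EuclideanSpace ℝ (Fin d) →L[ℝ]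
        EuclideanSpace ℝ (Fin d) →L[ℝ] EuclideanSpace ℝ (Fin d)))
    (hDH : ∀ ω, ∀ z ∈ Metric.ball uhat r, HasFDerivAt (H ω) (DH ω z) z)
    (hD2H : ∀ ω, ∀ z ∈ Metric.ball uhat r, HasFDerivAt (DH ω) (D2H ω z) z)
    (hD2H_cont : ∀ ω, ContinuousOn (D2H ω) (Metric.ball uhat r))
    (hH_bound : ∀ ω, ∀ z ∈ Metric.ball uhat r, ‖H ω z‖ ≤ L)
    (hDH_bound : ∀ ω, ∀ z ∈ Metric.ball uhat r, ‖DH ω z‖ ≤ L')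
    (hD2H_bound : ∀ ω, ∀ z ∈ Metric.ball uhat r, ‖D2H ω z‖ ≤ L'')
    (hmean : ∀ z ∈ Metric.ball uhat r, ∫ ω, H ω z ∂P = 0)
    (hcov : ∀ z ∈ Metric.ball uhat r, ∀ i j : Fin d,
      ∫ ω, H ω z i * H ω z j ∂P = if i = j then (1:ℝ) else 0) :
    (∀ i : Fin d,
      (∑ j : Fin d, ∫ ω, (DH ω uhat (EuclideanSpace.single j 1)) i * H ω uhat j ∂P)
        + (∑ j : Fin d,
            ∫ ω, (DH ω uhat (EuclideanSpace.single j 1)) j * H ω uhat i ∂P) = 0) ∧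
    (∫ ω,
        (2 * ∑ i : Fin d, ∑ j : Fin d,
            (D2H ω uhat (EuclideanSpace.single i 1) (EuclideanSpace.single j 1)) i
              * H ω uhat j
          + ∑ i : Fin d, ∑ j : Fin d,
              (DH ω uhat (EuclideanSpace.single j 1)) i
                * (DH ω uhat (EuclideanSpace.single i 1)) j
          + ∑ i : Fin d, ∑ j : Fin d,
              (DH ω uhat (EuclideanSpace.single i 1)) i
                * (DH ω uhat (EuclideanSpace.single j 1)) j) ∂P) = 0 := by
  set e : Fin d → EuclideanSpace ℝ (Fin d) := fun k => EuclideanSpace.single k 1 with he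
  have hnorm (k : Fin d) : ‖e k‖ = 1 := by simp [he]
  set S := Metric.ball uhat r
  have hS : IsOpen S := Metric.isOpen_ball
  have hu : uhat ∈ S := Metric.mem_ball_self hr
  have hHm (i : Fin d) (z : EuclideanSpace ℝ (Fin d)) :
      AEStronglyMeasurable (fun ω => H ω z i) P :=
    (((EuclideanSpace.proj (𝕜 := ℝ) i).continuous.measurable.comp
      (hH_meas.comp measurable_prodMk_right)).aestronglyMeasurable)
  have hHb (i : Fin d) (ω : Ω) : ∀ z ∈ S, ‖H ω z i‖ ≤ L := fun z hz =>
    (PiLp.norm_apply_le _ i).trans (hH_bound ω z hz)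
  have hDb (i k : Fin d) (ω : Ω) : ∀ z ∈ S, ‖DH ω z (e k) i‖ ≤ L' := fun z hz =>
    (PiLp.norm_apply_le _ i).trans <|
      (ContinuousLinearMap.le_of_opNorm_le _ (hDH_bound ω z hz) _).trans (by simp [hnorm])
  have hD2b (i k l : Fin d) (ω : Ω) : ∀ z ∈ S, ‖D2H ω z (e l) (e k) i‖ ≤ L'' := fun z hz =>
    (PiLp.norm_apply_le _ i).trans <|
      (ContinuousLinearMap.le_opNorm₂ _ _ _).trans (by simpa [hnorm] using hD2H_bound ω z hz)
  have hHd (i k : Fin d) (ω : Ω) : ∀ z ∈ S,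
      HasLineDerivAt ℝ (fun y => H ω y i) (DH ω z (e k) i) z (e k) := fun z hz =>
    ((hDH ω z hz).hasLineDerivAt (e k)).euclidean_apply i
  have hDd (i k l : Fin d) (ω : Ω) : ∀ z ∈ S,
      HasLineDerivAt ℝ (fun y => DH ω y (e k) i) (D2H ω z (e l) (e k) i) z (e l) := fun z hz =>
    have h : HasLineDerivAt ℝ (fun y => DH ω y (e k)) (D2H ω z (e l) (e k)) z (e l) :=
      (ContinuousLinearMap.apply ℝ (EuclideanSpace ℝ (Fin d)) (e k)).hasFDerivAt.comp_hasDerivAt _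
        ((hD2H ω z hz).hasLineDerivAt (e l))
    h.euclidean_apply i
  have hDm (i k : Fin d) : ∀ z ∈ S, AEStronglyMeasurable (fun ω => DH ω z (e k) i) P :=
    fun z hz => aestronglyMeasurable_of_hasLineDerivAt hS hz (fun y _ => hHm i y)
      fun ω => hHd i k ω z hz
  have first (i j k : Fin d) : ∀ z ∈ S,
      ∫ ω, (DH ω z (e k) i * H ω z j + H ω z i * DH ω z (e k) j) ∂P = 0 := fun z hz =>
    (integral_lineDeriv_eq_zero (f := fun ω y => H ω y i * H ω y j)
      (f' := fun ω y => DH ω y (e k) i * H ω y j + H ω y i * DH ω y (e k) j) hS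
      (fun y _ => (hHm i y).mul (hHm j y))
      (fun ω y hy => norm_mul_le_of_norm_le (hHb i ω y hy) (hHb j ω y hy))
      (fun ω y hy => norm_add_le_of_le
        (norm_mul_le_of_norm_le (hDb i k ω y hy) (hHb j ω y hy))
        (norm_mul_le_of_norm_le (hHb i ω y hy) (hDb j k ω y hy)))
      (fun ω y hy => (hHd i k ω y hy).mul_real (hHd j k ω y hy))
      (fun y hy => hcov y hy i j) hz).2
  have second (i j k l : Fin d) :=
    integral_lineDeriv_eq_zero (P := P)
      (f := fun ω y => DH ω y (e k) i * H ω y j + H ω y i * DH ω y (e k) j)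
      (f' := fun ω y => (D2H ω y (e l) (e k) i * H ω y j + DH ω y (e k) i * DH ω y (e l) j)
        + (DH ω y (e l) i * DH ω y (e k) j + H ω y i * D2H ω y (e l) (e k) j)) hS
      (fun y hy => ((hDm i k y hy).mul (hHm j y)).add ((hHm i y).mul (hDm j k y hy)))
      (fun ω y hy => norm_add_le_of_le
        (norm_mul_le_of_norm_le (hDb i k ω y hy) (hHb j ω y hy))
        (norm_mul_le_of_norm_le (hHb i ω y hy) (hDb j k ω y hy)))
      (fun ω y hy => norm_add_le_of_le
        (norm_add_le_of_le
          (norm_mul_le_of_norm_le (hD2b i k l ω y hy) (hHb j ω y hy))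
          (norm_mul_le_of_norm_le (hDb i k ω y hy) (hDb j l ω y hy)))
        (norm_add_le_of_le
          (norm_mul_le_of_norm_le (hDb i l ω y hy) (hDb j k ω y hy))
          (norm_mul_le_of_norm_le (hHb i ω y hy) (hD2b j k l ω y hy))))
      (fun ω y hy => ((hDd i k l ω y hy).mul_real (hHd j l ω y hy)).add
        ((hHd i l ω y hy).mul_real (hDd j k l ω y hy)))
      (first i j k) hu
  have hint (i j k : Fin d) : Integrable (fun ω => DH ω uhat (e k) i * H ω uhat j) P :=
    Integrable.of_bound ((hDm i k uhat hu).mul (hHm j uhat)) (L' * L)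
      (ae_of_all _ fun ω => norm_mul_le_of_norm_le (hDb i k ω uhat hu) (hHb j ω uhat hu))
  refine ⟨fun i => ?_, ?_⟩
  · rw [← Finset.sum_add_distrib]
    refine Finset.sum_eq_zero fun j _ => ?_
    rw [← integral_add (hint i j j) (hint j i j), ← first i j j uhat hu]
    simp only [mul_comm (H _ uhat i)]
  · have hsum : ∫ ω, (∑ i : Fin d, ∑ j : Fin d,
        ((D2H ω uhat (e i) (e j) i * H ω uhat j + DH ω uhat (e j) i * DH ω uhat (e i) j)
        + (DH ω uhat (e i) i * DH ω uhat (e j) j + H ω uhat i * D2H ω uhat (e i) (e j) j)))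
        ∂P = 0 := by
      rw [integral_finsetSum _ fun i _ => integrable_finsetSum _ fun j _ => (second i j j i).1]
      refine Finset.sum_eq_zero fun i _ => ?_
      rw [integral_finsetSum _ fun j _ => (second i j j i).1]
      exact Finset.sum_eq_zero fun j _ => (second i j j i).2
    rw [← hsum]
    refine integral_congr_ae (ae_of_all _ fun ω => ?_)
    have hsymm (i j : Fin d) : D2H ω uhat (e i) (e j) = D2H ω uhat (e j) (e i) :=
      second_derivative_symmetric_of_eventually
        (Filter.mem_of_superset (hS.mem_nhds hu) (hDH ω)) (hD2H ω uhat hu) _ _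
    have hswap : ∑ i : Fin d, ∑ j : Fin d, H ω uhat i * D2H ω uhat (e i) (e j) j
        = ∑ i : Fin d, ∑ j : Fin d, D2H ω uhat (e i) (e j) i * H ω uhat j := by
      rw [Finset.sum_comm]
      refine Finset.sum_congr rfl fun i _ => Finset.sum_congr rfl fun j _ => ?_
      rw [hsymm j i, mul_comm]
    simp only [Finset.sum_add_distrib, hswap]
    ring
end
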